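/- arXiv:0705.2492 — 3 statements merged into one kernel-verified Lean document; each statement's English description precedes it below -/
import Mathlib

section
/- Let K be a field of characteristic zero and X a rank-two irreducible locally nilpotent K-derivation of K[x,y,z]. Write K[x,y,z]^X = K[u,p] where u is a coordinate of K[x,y,z], let s be a minimal local slice of X, and write X(s) = c(u) = c1^{n1}···cr^{nr}, where the ci are irreducible in K[u] and pairwise non-associate. Then X is triangulable if and only if for every i = 1,…,r the ideal I_{c_i^{n_i}}^X = c_i^{n_i}·K[x,y,z] ∩ K[u,p,s] contains a polynomial H_i such that H_i ≡ p + Q_i(u, s + ℓ_i(u,p)) modulo c_i^{n_i}, where Q_i and ℓ_i are polynomials in one variable with coefficients in K[u]. -/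
noncomputable section

variable (K : Type) [Field K] [CharZero K]

abbrev PolyR (K : Type) [Field K] : Type := MvPolynomial (Fin 3) K

/-- A derivation is locally nilpotent if every element is killed by some iterate. -/
def LND (X : Derivation K (PolyR K) (PolyR K)) : Prop :=
  ∀ a : PolyR K, ∃ n : ℕ, 0 < n ∧ (⇑X)^[n] a = 0

/-- `X` is irreducible: every common divisor of `X x, X y, X z` is a unit. -/
def IrredDer (X : Derivation K (PolyR K) (PolyR K)) : Prop :=
  ∀ d : PolyR K, (∀ i : Fin 3, d ∣ X (MvPolynomial.X i)) → IsUnit d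

def IsCoord (f : PolyR K) : Prop :=
  ∃ g h : PolyR K, Algebra.adjoin K {f, g, h} = ⊤

def IsCoordSys (u v w : PolyR K) : Prop := Algebra.adjoin K {u, v, w} = ⊤

def IsSysOfCoords2 (u v : PolyR K) : Prop :=
  ∃ w : PolyR K, Algebra.adjoin K {u, v, w} = ⊤

/-- The corank of a derivation: the largest length of a system of coordinates in the kernel. -/
def corank (X : Derivation K (PolyR K) (PolyR K)) : ℕ :=
  sSup {r : ℕ | ∃ l : List (PolyR K), l.length = r ∧ (∀ f ∈ l, X f = 0) ∧
    ∃ m : List (PolyR K), (l ++ m).length = 3 ∧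
      Algebra.adjoin K {a : PolyR K | a ∈ l ++ m} = ⊤}

def rankD (X : Derivation K (PolyR K) (PolyR K)) : ℕ := 3 - corank K X

def IsLocalSlice (X : Derivation K (PolyR K) (PolyR K)) (s : PolyR K) : Prop :=
  X s ≠ 0 ∧ X (X s) = 0

def IsMinLocalSlice (X : Derivation K (PolyR K) (PolyR K)) (s : PolyR K) : Prop :=
  IsLocalSlice K X s ∧ ∀ v : PolyR K, IsLocalSlice K X v → X v ∣ X s →
    ∃ μ : (PolyR K)ˣ, X v = (μ : PolyR K) * X s

/-- `c` generates the plinth ideal `S^X = {X a : X² a = 0}` as an ideal of the constants. -/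
def IsPlinthGen (X : Derivation K (PolyR K) (PolyR K)) (c : PolyR K) : Prop :=
  {d : PolyR K | ∃ a : PolyR K, X a = d ∧ X (X a) = 0} =
    {d : PolyR K | ∃ r : PolyR K, X r = 0 ∧ d = r * c}

/-- `X` is triangulable: triangular in some coordinate system. -/
def Triangulable (X : Derivation K (PolyR K) (PolyR K)) : Prop :=
  ∃ u v w : PolyR K, IsCoordSys K u v w ∧
    X u ∈ (⊥ : Subalgebra K (PolyR K)) ∧
    X v ∈ Algebra.adjoin K {u} ∧
    X w ∈ Algebra.adjoin K {u, v}

/-- Evaluation of `Q ∈ K[u][T]` at `T = t`, with coefficients evaluated at `u`. -/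
def ev2 (u t : PolyR K) (Q : Polynomial (Polynomial K)) : PolyR K :=
  Polynomial.eval₂ (Polynomial.aeval u).toRingHom t Q

/-- The Jacobian derivation `Jac(f,g,·)` applied to `h`. -/
def jacDet (f g h : PolyR K) : PolyR K :=
  Matrix.det !![MvPolynomial.pderiv 0 f, MvPolynomial.pderiv 1 f, MvPolynomial.pderiv 2 f;
    MvPolynomial.pderiv 0 g, MvPolynomial.pderiv 1 g, MvPolynomial.pderiv 2 g;
    MvPolynomial.pderiv 0 h, MvPolynomial.pderiv 1 h, MvPolynomial.pderiv 2 h]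


/-- Evaluation `K[T][S] → A`, `T ↦ u`, `S ↦ v`. -/
def E2 {K : Type} [Field K] (u v : PolyR K) : Polynomial (Polynomial K) →+* PolyR K :=
  Polynomial.eval₂RingHom (Polynomial.aeval u).toRingHom v

/-- Evaluation `K[T][S][W] → A`. -/
def E3 {K : Type} [Field K] (u v w : PolyR K) :
    Polynomial (Polynomial (Polynomial K)) →+* PolyR K :=
  Polynomial.eval₂RingHom (E2 u v) w

theorem ev2_eq {K : Type} [Field K] (u v : PolyR K) (F : Polynomial (Polynomial K)) :
    ev2 K u v F = E2 u v F := rfl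

@[simp] theorem E2_C {K : Type} [Field K] (u v : PolyR K) (a : Polynomial K) :
    E2 u v (Polynomial.C a) = Polynomial.aeval u a := by
  simp [E2]

@[simp] theorem E2_X {K : Type} [Field K] (u v : PolyR K) :
    E2 u v Polynomial.X = v := by
  simp [E2]

@[simp] theorem E3_C {K : Type} [Field K] (u v w : PolyR K) (a : Polynomial (Polynomial K)) :
    E3 u v w (Polynomial.C a) = E2 u v a := by
  simp [E3]

@[simp] theorem E3_X {K : Type} [Field K] (u v w : PolyR K) :
    E3 u v w Polynomial.X = w := by
  simp [E3]

theorem E2_comp {K : Type} [Field K] (u v : PolyR K) (F G : Polynomial (Polynomial K)) :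
    E2 u v (F.comp G) = E2 u (E2 u v G) F := by
  simp only [E2, Polynomial.coe_eval₂RingHom]
  rw [Polynomial.eval₂_comp]

theorem aeval_mem_adj {K : Type} [Field K] (S : Subalgebra K (PolyR K)) (u : PolyR K)
    (hu : u ∈ S) (f : Polynomial K) : Polynomial.aeval u f ∈ S := by
  have h := Polynomial.aeval_mem_adjoin_singleton K (p := f) u
  have h2 : Algebra.adjoin K {u} ≤ S := Algebra.adjoin_le (by simpa using hu)
  exact h2 h

theorem E2_mem {K : Type} [Field K] (S : Subalgebra K (PolyR K)) (u v : PolyR K)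
    (hu : u ∈ S) (hv : v ∈ S) (F : Polynomial (Polynomial K)) : E2 u v F ∈ S := by
  induction F using Polynomial.induction_on' with
  | add F G hF hG => rw [map_add]; exact S.add_mem hF hG
  | monomial n a =>
    rw [← Polynomial.C_mul_X_pow_eq_monomial, map_mul, map_pow, E2_C, E2_X]
    exact S.mul_mem (aeval_mem_adj S u hu a) (S.pow_mem hv n)

theorem E3_mem {K : Type} [Field K] (S : Subalgebra K (PolyR K)) (u v w : PolyR K)
    (hu : u ∈ S) (hv : v ∈ S) (hw : w ∈ S)
    (F : Polynomial (Polynomial (Polynomial K))) : E3 u v w F ∈ S := by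
  induction F using Polynomial.induction_on' with
  | add F G hF hG => rw [map_add]; exact S.add_mem hF hG
  | monomial n a =>
    rw [← Polynomial.C_mul_X_pow_eq_monomial, map_mul, map_pow, E3_C, E3_X]
    exact S.mul_mem (E2_mem S u v hu hv a) (S.pow_mem hw n)

theorem exists_aeval {K : Type} [Field K] {u a : PolyR K}
    (ha : a ∈ Algebra.adjoin K {u}) : ∃ f : Polynomial K, Polynomial.aeval u f = a := by
  rw [Algebra.adjoin_singleton_eq_range_aeval] at ha
  exact ha

theorem exists_E2 {K : Type} [Field K] {u v a : PolyR K}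
    (ha : a ∈ Algebra.adjoin K {u, v}) : ∃ F, E2 u v F = a := by
  induction ha using Algebra.adjoin_induction with
  | mem x hx =>
    rcases hx with rfl | hx
    · exact ⟨Polynomial.C Polynomial.X, by simp⟩
    · rw [Set.mem_singleton_iff] at hx
      subst hx
      exact ⟨Polynomial.X, by simp⟩
  | algebraMap r => exact ⟨Polynomial.C (Polynomial.C r), by simp⟩
  | add x y _ _ hx hy =>
    obtain ⟨F, rfl⟩ := hx
    obtain ⟨G, rfl⟩ := hy
    exact ⟨F + G, map_add _ _ _⟩
  | mul x y _ _ hx hy =>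
    obtain ⟨F, rfl⟩ := hx
    obtain ⟨G, rfl⟩ := hy
    exact ⟨F * G, map_mul _ _ _⟩

theorem exists_E3 {K : Type} [Field K] {u v w a : PolyR K}
    (ha : a ∈ Algebra.adjoin K {u, v, w}) : ∃ F, E3 u v w F = a := by
  induction ha using Algebra.adjoin_induction with
  | mem x hx =>
    rcases hx with rfl | rfl | hx
    · exact ⟨Polynomial.C (Polynomial.C Polynomial.X), by simp⟩
    · exact ⟨Polynomial.C Polynomial.X, by simp⟩
    · rw [Set.mem_singleton_iff] at hx
      subst hx
      exact ⟨Polynomial.X, by simp⟩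
  | algebraMap r => exact ⟨Polynomial.C (Polynomial.C (Polynomial.C r)), by simp⟩
  | add x y _ _ hx hy =>
    obtain ⟨F, rfl⟩ := hx
    obtain ⟨G, rfl⟩ := hy
    exact ⟨F + G, map_add _ _ _⟩
  | mul x y _ _ hx hy =>
    obtain ⟨F, rfl⟩ := hx
    obtain ⟨G, rfl⟩ := hy
    exact ⟨F * G, map_mul _ _ _⟩

theorem der_aeval {K : Type} [Field K] (X : Derivation K (PolyR K) (PolyR K)) {u : PolyR K}
    (hu : X u = 0) (f : Polynomial K) : X (Polynomial.aeval u f) = 0 := by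
  rw [Derivation.map_aeval, hu, smul_zero]

theorem der_E2 {K : Type} [Field K] (X : Derivation K (PolyR K) (PolyR K)) {u : PolyR K}
    (hu : X u = 0) (v : PolyR K) (F : Polynomial (Polynomial K)) :
    X (E2 u v F) = E2 u v (Polynomial.derivative F) * X v := by
  induction F using Polynomial.induction_on' with
  | add F G hF hG => simp only [map_add, hF, hG, add_mul]
  | monomial n a =>
    rw [← Polynomial.C_mul_X_pow_eq_monomial, Polynomial.derivative_C_mul_X_pow]
    simp only [map_mul, map_pow, E2_C, E2_X, Derivation.leibniz, der_aeval X hu,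
      Derivation.leibniz_pow, smul_eq_mul, nsmul_eq_mul, map_natCast]
    ring

theorem der_E3 {K : Type} [Field K] (X : Derivation K (PolyR K) (PolyR K)) {u v : PolyR K}
    (hu : X u = 0) (w q : PolyR K) (hq : q ∣ X v) (F : Polynomial (Polynomial (Polynomial K))) :
    q ∣ X (E3 u v w F) - E3 u v w (Polynomial.derivative F) * X w := by
  induction F using Polynomial.induction_on' with
  | add F G hF hG =>
    have := dvd_add hF hG
    simp only [map_add]
    convert this using 1
    ring
  | monomial n a =>
    rw [← Polynomial.C_mul_X_pow_eq_monomial, Polynomial.derivative_C_mul_X_pow]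
    simp only [map_mul, map_pow, E3_C, E3_X, Derivation.leibniz, der_E2 X hu,
      Derivation.leibniz_pow, smul_eq_mul, nsmul_eq_mul, map_natCast]
    obtain ⟨k, hk⟩ := hq
    rw [hk]
    exact ⟨w ^ n * E2 u v (Polynomial.derivative a) * k, by ring⟩

theorem dvd_of_dvd_derivative {S : Type} [CommRing S] [Algebra ℚ S] (a : S) (F : Polynomial S)
    (h : Polynomial.C a ∣ Polynomial.derivative F) :
    Polynomial.C a ∣ F - Polynomial.C (F.coeff 0) := by
  rw [Polynomial.C_dvd_iff_dvd_coeff] at h ⊢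
  intro i
  rcases i with _ | i
  · simp
  · have := h i
    rw [Polynomial.coeff_derivative] at this
    have hun : IsUnit ((i : S) + 1) := by
      have : ((i : S) + 1) = algebraMap ℚ S ((i : ℚ) + 1) := by simp
      rw [this]
      exact (IsUnit.mk0 _ (by positivity)).map _
    rw [Polynomial.coeff_sub, Polynomial.coeff_C_succ, sub_zero]
    exact hun.dvd_mul_right.mp this

theorem exists_of_dvd_derivative {S : Type} [CommRing S] [Algebra ℚ S] (a : S) (F : Polynomial S)
    (h : Polynomial.C a ∣ Polynomial.derivative F) :
    ∃ k, F = Polynomial.C (F.coeff 0) + Polynomial.C a * k := by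
  obtain ⟨k, hk⟩ := dvd_of_dvd_derivative a F h
  exact ⟨k, by rw [← hk]; ring⟩

/-- algebraic independence in the form needed -/
theorem E3_injective {K : Type} [Field K] (u v w : PolyR K)
    (h : ∀ a : PolyR K, ∃ b ∈ Algebra.adjoin K {u, v, w}, b ≠ 0 ∧
      b * a ∈ Algebra.adjoin K {u, v, w}) : Function.Injective (E3 u v w) := by
  have hr : Set.range ![u, v, w] = {u, v, w} := by
    ext a
    simp [eq_comm]
    tauto
  have halg : Algebra.IsAlgebraic (Algebra.adjoin K (Set.range ![u, v, w])) (PolyR K) := by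
    rw [hr]
    constructor
    intro a
    obtain ⟨b, hb, hb0, hba⟩ := h a
    refine ⟨Polynomial.C ⟨b, hb⟩ * Polynomial.X - Polynomial.C ⟨b * a, hba⟩, ?_, ?_⟩
    · intro h0
      have := congrArg (fun f => f.coeff 1) h0
      simp [Polynomial.coeff_C] at this
      exact hb0 (congrArg Subtype.val this)
    · simp
  have hb : IsTranscendenceBasis K ![u, v, w] := by
    apply Algebra.IsAlgebraic.isTranscendenceBasis_of_le_trdeg_of_finite
    rw [MvPolynomial.trdeg_of_isDomain]
    simp
  have hai : Function.Injective (MvPolynomial.aeval ![u, v, w] : MvPolynomial (Fin 3) K →ₐ[K] _) :=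
    hb.1
  let ψ : MvPolynomial (Fin 3) K →ₐ[K] Polynomial (Polynomial (Polynomial K)) :=
    MvPolynomial.aeval (![Polynomial.C (Polynomial.C Polynomial.X), Polynomial.C Polynomial.X,
      Polynomial.X] : Fin 3 → Polynomial (Polynomial (Polynomial K)))
  have hcomp : ∀ a, E3 u v w (ψ a) = MvPolynomial.aeval ![u, v, w] a := by
    intro a
    induction a using MvPolynomial.induction_on with
    | C r =>
      have : ψ (MvPolynomial.C r) = Polynomial.C (Polynomial.C (Polynomial.C r)) := by
        simp [ψ]
      rw [this]
      simp
    | add a b ha hb => simp only [map_add, ha, hb]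
    | mul_X a i ha =>
      rw [map_mul, map_mul, map_mul, ha]
      fin_cases i <;> simp [ψ]
  have hsurj : Function.Surjective ψ := by
    have h1 : ∀ f : Polynomial K, Polynomial.C (Polynomial.C f) ∈ ψ.range := by
      intro f
      induction f using Polynomial.induction_on with
      | C a => exact ⟨MvPolynomial.C a, by simp [ψ]⟩
      | add f g hf hg => rw [map_add, map_add]; exact add_mem hf hg
      | monomial n a hf =>
        rw [pow_succ, ← mul_assoc, map_mul, map_mul]
        exact mul_mem hf ⟨MvPolynomial.X 0, by simp [ψ]⟩
    have h2 : ∀ f : Polynomial (Polynomial K), Polynomial.C f ∈ ψ.range := by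
      intro f
      induction f using Polynomial.induction_on with
      | C a => exact h1 a
      | add f g hf hg => rw [map_add]; exact add_mem hf hg
      | monomial n a hf =>
        rw [pow_succ, ← mul_assoc, map_mul]
        exact mul_mem hf ⟨MvPolynomial.X 1, by simp [ψ]⟩
    intro f
    change f ∈ ψ.range
    induction f using Polynomial.induction_on with
    | C a => exact h2 a
    | add f g hf hg => exact add_mem hf hg
    | monomial n a hf =>
      rw [pow_succ, ← mul_assoc]
      exact mul_mem hf ⟨MvPolynomial.X 2, by simp [ψ]⟩
  intro x y hxy
  obtain ⟨a, rfl⟩ := hsurj x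
  obtain ⟨b, rfl⟩ := hsurj y
  rw [hcomp, hcomp] at hxy
  rw [hai hxy]

theorem E3_bij {K : Type} [Field K] (u v w : PolyR K)
    (h : Algebra.adjoin K {u, v, w} = ⊤) : Function.Bijective (E3 u v w) := by
  constructor
  · apply E3_injective
    intro a
    exact ⟨1, one_mem _, one_ne_zero, by rw [h]; trivial⟩
  · intro a
    exact exists_E3 (by rw [h]; trivial)

theorem exists_residue {K : Type} [Field K] (u v w : PolyR K)
    (h : Algebra.adjoin K {u, v, w} = ⊤) (q : Polynomial K) (hq : Irreducible q) :
    ∃ (L : Type) (_ : Field L) (ρ : Polynomial K →+* L)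
      (π : PolyR K →+* Polynomial (Polynomial L)),
      Function.Surjective ρ ∧ (∀ a, ρ a = 0 ↔ q ∣ a) ∧
      (∀ f, π (Polynomial.aeval u f) = Polynomial.C (Polynomial.C (ρ f))) ∧
      (∀ a, π a = 0 ↔ Polynomial.aeval u q ∣ a) := by
  have : Fact (Irreducible q) := ⟨hq⟩
  let E : Polynomial (Polynomial (Polynomial K)) ≃+* PolyR K :=
    RingEquiv.ofBijective (E3 u v w) (E3_bij u v w h)
  have hE : ∀ f, E.symm (Polynomial.aeval u f) = Polynomial.C (Polynomial.C f) := by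
    intro f
    rw [RingEquiv.symm_apply_eq]
    change _ = E3 u v w _
    simp
  have hρ : ∀ a, AdjoinRoot.mk q a = 0 ↔ q ∣ a := fun a => AdjoinRoot.mk_eq_zero
  refine ⟨AdjoinRoot q, inferInstance, AdjoinRoot.mk q,
    (Polynomial.mapRingHom (Polynomial.mapRingHom (AdjoinRoot.mk q))).comp E.symm.toRingHom,
    AdjoinRoot.mk_surjective, hρ, ?_, ?_⟩
  · intro f
    have : E.symm.toRingHom (Polynomial.aeval u f) = Polynomial.C (Polynomial.C f) := hE f
    rw [RingHom.comp_apply, this]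
    simp
  · intro a
    have h1 : Polynomial.aeval u q ∣ a ↔ Polynomial.C (Polynomial.C q) ∣ E.symm a := by
      rw [← hE q]
      exact (map_dvd_iff E.symm).symm
    rw [h1, RingHom.comp_apply]
    change Polynomial.mapRingHom _ (E.symm a) = 0 ↔ _
    rw [Polynomial.C_dvd_iff_dvd_coeff, Polynomial.ext_iff]
    simp only [Polynomial.C_dvd_iff_dvd_coeff, Polynomial.coe_mapRingHom, Polynomial.coeff_map,
      Polynomial.coeff_zero]
    simp only [Polynomial.ext_iff, Polynomial.coeff_map, Polynomial.coeff_zero, hρ]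

theorem res_E2 {K : Type} [Field K] {u : PolyR K} {L : Type} [Field L] {ρ : Polynomial K →+* L}
    {π : PolyR K →+* Polynomial (Polynomial L)}
    (h : ∀ f, π (Polynomial.aeval u f) = Polynomial.C (Polynomial.C (ρ f)))
    (t : PolyR K) (F : Polynomial (Polynomial K)) :
    π (E2 u t F) = Polynomial.eval₂ (Polynomial.C.comp Polynomial.C) (π t) (F.map ρ) := by
  induction F using Polynomial.induction_on' with
  | add F G hF hG => simp only [map_add, hF, hG, Polynomial.map_add, Polynomial.eval₂_add]
  | monomial n a =>
    rw [← Polynomial.C_mul_X_pow_eq_monomial]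
    simp [h]

theorem alg_const1 {D : Type} [CommRing D] [IsDomain D] (F : Polynomial D) (hF : F.natDegree ≠ 0)
    (t : Polynomial D) (b : D) (h : Polynomial.eval₂ Polynomial.C t F = Polynomial.C b) :
    ∃ l, t = Polynomial.C l := by
  have h1 : (F.comp t) = Polynomial.C b := h
  have h2 := congrArg Polynomial.natDegree h1
  rw [Polynomial.natDegree_comp, Polynomial.natDegree_C] at h2
  have h3 : t.natDegree = 0 := by
    rcases Nat.mul_eq_zero.mp h2 with h | h
    · exact absurd h hF
    · exact h
  exact ⟨_, Polynomial.eq_C_of_natDegree_eq_zero h3⟩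

/-- a non constant polynomial takes constant values only at constants -/
theorem alg_const2 {L : Type} [CommRing L] [IsDomain L] (F : Polynomial L) (hF : F.natDegree ≠ 0)
    (t : Polynomial (Polynomial L)) (b : L)
    (h : Polynomial.eval₂ (Polynomial.C.comp Polynomial.C) t F =
      Polynomial.C (Polynomial.C b)) :
    ∃ l, t = Polynomial.C (Polynomial.C l) := by
  have h1 : Polynomial.eval₂ Polynomial.C t (F.map Polynomial.C) =
      Polynomial.C (Polynomial.C b) := by
    rw [Polynomial.eval₂_map]; exact h
  obtain ⟨l, rfl⟩ := alg_const1 (F.map Polynomial.C)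
    (by rwa [Polynomial.natDegree_map_eq_of_injective Polynomial.C_injective]) t _ h1
  rw [← Polynomial.hom_eval₂, Polynomial.C_inj] at h
  obtain ⟨m, rfl⟩ := alg_const1 F hF l b h
  exact ⟨m, rfl⟩

theorem alg_const {L : Type} [Field L] (F : Polynomial L) (hF : F ≠ 0)
    (t : Polynomial (Polynomial L))
    (h : Polynomial.eval₂ (Polynomial.C.comp Polynomial.C) t F = 0) :
    ∃ l, t = Polynomial.C (Polynomial.C l) := by
  by_cases h0 : F.natDegree = 0
  · exfalso
    rw [Polynomial.eq_C_of_natDegree_eq_zero h0] at h hF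
    simp at h hF
    exact hF h
  · exact alg_const2 F h0 t 0 (by simpa using h)

/-- `K[u]/q` is algebraically closed in `A/q`. -/
theorem coord_alg {K : Type} [Field K] (u : PolyR K) (hu : IsCoord K u)
    (q : Polynomial K) (hq : Irreducible q) (t : PolyR K) (F : Polynomial (Polynomial K))
    (h : Polynomial.aeval u q ∣ E2 u t F)
    (ht : ∀ a : Polynomial K, ¬ Polynomial.aeval u q ∣ t - Polynomial.aeval u a) :
    Polynomial.C q ∣ F := by
  obtain ⟨v, w, hvw⟩ := hu
  obtain ⟨L, _, ρ, π, hsurj, hρ, hπu, hπ⟩ := exists_residue u v w hvw q hq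
  rw [← hπ, res_E2 hπu] at h
  by_contra hF
  have hF0 : F.map ρ ≠ 0 := by
    intro h0
    apply hF
    rw [Polynomial.C_dvd_iff_dvd_coeff]
    intro i
    rw [← hρ, ← Polynomial.coeff_map, h0, Polynomial.coeff_zero]
  obtain ⟨l, hl⟩ := alg_const _ hF0 _ h
  obtain ⟨a, rfl⟩ := hsurj l
  apply ht a
  rw [← hπ, map_sub, hl, hπu, sub_self]

theorem coord_prime {K : Type} [Field K] (u : PolyR K) (hu : IsCoord K u)
    (q : Polynomial K) (hq : Irreducible q) : Prime (Polynomial.aeval u q) := by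
  obtain ⟨v, w, hvw⟩ := hu
  obtain ⟨L, _, ρ, π, hsurj, hρ, hπu, hπ⟩ := exists_residue u v w hvw q hq
  refine ⟨?_, ?_, ?_⟩
  · intro h0
    have h1 : E3 u v w (Polynomial.C (Polynomial.C q)) = E3 u v w 0 := by
      simp [h0]
    have h2 := (E3_bij u v w hvw).1 h1
    simp at h2
    exact hq.ne_zero h2
  · intro h
    have h1 := h.map π
    rw [(hπ _).mpr dvd_rfl] at h1
    exact not_isUnit_zero h1
  · intro a b hab
    rw [← hπ, map_mul, mul_eq_zero] at hab
    rwa [← hπ, ← hπ]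

/-- `L(p) ∩ L[x,y] = L[p]` residually. -/
theorem coord_frac {K : Type} [Field K] (u : PolyR K) (hu : IsCoord K u)
    (q : Polynomial K) (hq : Irreducible q) (p s : PolyR K) (D G : Polynomial (Polynomial K))
    (hp : ∀ a : Polynomial K, ¬ Polynomial.aeval u q ∣ p - Polynomial.aeval u a)
    (hD : ¬ Polynomial.aeval u q ∣ E2 u p D)
    (h : Polynomial.aeval u q ∣ E2 u p D * s + E2 u p G) :
    ∃ H : Polynomial (Polynomial K), Polynomial.aeval u q ∣ s - E2 u p H := by
  obtain ⟨v, w, hvw⟩ := hu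
  obtain ⟨L, _, ρ, π, hsurj, hρ, hπu, hπ⟩ := exists_residue u v w hvw q hq
  have hpt : ∀ f : Polynomial L,
      Polynomial.eval₂ (Polynomial.C.comp Polynomial.C) (π p) f = 0 → f = 0 := by
    intro f hf
    by_contra hf0
    obtain ⟨l, hl⟩ := alg_const _ hf0 _ hf
    obtain ⟨a, rfl⟩ := hsurj l
    apply hp a
    rw [← hπ, map_sub, hl, hπu, sub_self]
  rw [← hπ, res_E2 hπu] at hD
  rw [← hπ, map_add, map_mul, res_E2 hπu, res_E2 hπu] at h
  set θ : Polynomial L →+* Polynomial (Polynomial L) :=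
    Polynomial.eval₂RingHom (Polynomial.C.comp Polynomial.C) (π p) with hθ
  change ∀ f, θ f = 0 → f = 0 at hpt
  change ¬ θ (D.map ρ) = 0 at hD
  change θ (D.map ρ) * π s + θ (G.map ρ) = 0 at h
  have hD0 : D.map ρ ≠ 0 := by
    intro h0
    rw [h0, map_zero] at hD
    exact hD rfl
  obtain ⟨D1, G1, hcop, g, hg1, hg2⟩ : ∃ D1 G1 : Polynomial L, IsCoprime D1 G1 ∧
      ∃ g, D.map ρ = g * D1 ∧ G.map ρ = g * G1 := by
    classical
    have hne : EuclideanDomain.gcd (D.map ρ) (G.map ρ) ≠ 0 := by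
      intro h0
      rw [EuclideanDomain.gcd_eq_zero_iff] at h0
      exact hD0 h0.1
    obtain ⟨D1, hD1⟩ := EuclideanDomain.gcd_dvd_left (D.map ρ) (G.map ρ)
    obtain ⟨G1, hG1⟩ := EuclideanDomain.gcd_dvd_right (D.map ρ) (G.map ρ)
    have hab := EuclideanDomain.gcd_eq_gcd_ab (D.map ρ) (G.map ρ)
    refine ⟨D1, G1, ?_, _, hD1, hG1⟩
    refine ⟨EuclideanDomain.gcdA (D.map ρ) (G.map ρ),
      EuclideanDomain.gcdB (D.map ρ) (G.map ρ), ?_⟩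
    generalize EuclideanDomain.gcdA (D.map ρ) (G.map ρ) = a at *
    generalize EuclideanDomain.gcdB (D.map ρ) (G.map ρ) = b at *
    generalize EuclideanDomain.gcd (D.map ρ) (G.map ρ) = g at *
    apply mul_left_cancel₀ hne
    rw [hD1, hG1] at hab
    linear_combination -hab
  have hg0 : θ g ≠ 0 := by
    intro h0
    rw [hg1, map_mul, h0, zero_mul] at hD
    exact hD rfl
  have h1 : θ D1 * π s + θ G1 = 0 := by
    apply mul_left_cancel₀ hg0
    rw [hg1, hg2, map_mul, map_mul] at h
    linear_combination h
  obtain ⟨a, b, hab⟩ := hcop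
  have h2 : θ D1 * (θ a - θ b * π s) = 1 := by
    have := congrArg θ hab
    simp only [map_add, map_mul, map_one] at this
    linear_combination this - θ b * h1
  have hun : IsUnit (θ D1) := IsUnit.of_mul_eq_one _ h2
  obtain ⟨d1, hd1, hd2⟩ := Polynomial.isUnit_iff.mp hun
  obtain ⟨d, hd, hdd⟩ := Polynomial.isUnit_iff.mp hd1
  have h3 : D1 = Polynomial.C d := by
    rw [← sub_eq_zero]
    apply hpt
    rw [map_sub, ← hd2, ← hdd]
    simp [hθ]
  have hd0 : d ≠ 0 := hd.ne_zero
  obtain ⟨H, hH⟩ : ∃ H : Polynomial (Polynomial K), H.map ρ = -(Polynomial.C d⁻¹ * G1) :=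
    Polynomial.map_surjective ρ hsurj _
  refine ⟨H, ?_⟩
  rw [← hπ, map_sub, res_E2 hπu, hH]
  change π s - θ (-(Polynomial.C d⁻¹ * G1)) = 0
  have h4 : θ (Polynomial.C d⁻¹) * θ D1 = 1 := by
    rw [h3, ← map_mul, ← map_mul, inv_mul_cancel₀ hd0]
    simp
  rw [map_neg, map_mul]
  linear_combination θ (Polynomial.C d⁻¹) * h1 - π s * h4

theorem iter_mul {K : Type} [Field K] (X : Derivation K (PolyR K) (PolyR K)) {k : PolyR K}
    (hk : X k = 0) (n : ℕ) (a : PolyR K) : (⇑X)^[n] (k * a) = k * (⇑X)^[n] a := by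
  induction n generalizing a with
  | zero => rfl
  | succ n ih =>
    rw [Function.iterate_succ_apply, Function.iterate_succ_apply, ← ih]
    congr 1
    simp [hk]

theorem iter_zero {K : Type} [Field K] (X : Derivation K (PolyR K) (PolyR K)) (n : ℕ) :
    (⇑X)^[n] (0 : PolyR K) = 0 := by
  induction n with
  | zero => rfl
  | succ n ih => rw [Function.iterate_succ_apply, map_zero, ih]

theorem iter_sub {K : Type} [Field K] (X : Derivation K (PolyR K) (PolyR K)) (n : ℕ)
    (a b : PolyR K) : (⇑X)^[n] (a - b) = (⇑X)^[n] a - (⇑X)^[n] b := by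
  induction n generalizing a b with
  | zero => rfl
  | succ n ih =>
    rw [Function.iterate_succ_apply, Function.iterate_succ_apply, Function.iterate_succ_apply,
      map_sub, ih]

theorem iter_pow {K : Type} [Field K] (X : Derivation K (PolyR K) (PolyR K)) {s : PolyR K}
    (hs : X (X s) = 0) (n : ℕ) : (⇑X)^[n] (s ^ n) = (n.factorial : PolyR K) * X s ^ n := by
  induction n with
  | zero => simp
  | succ n ih =>
    rw [Function.iterate_succ_apply, Derivation.leibniz_pow]
    have h1 : (n + 1) • s ^ (n + 1 - 1) • X s = (((n + 1 : ℕ) : PolyR K) * X s) * s ^ n := by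
      simp
      ring
    rw [h1, iter_mul X, ih, Nat.factorial_succ]
    · push_cast
      ring
    · simp [hs]

theorem slice_lemma {K : Type} [Field K] [CharZero K] (X : Derivation K (PolyR K) (PolyR K))
    (hln : LND K X) {s : PolyR K} (hs : X (X s) = 0) (S : Subalgebra K (PolyR K))
    (hS : ∀ a, X a = 0 → a ∈ S) (hsS : s ∈ S) (a : PolyR K) : ∃ N : ℕ, X s ^ N * a ∈ S := by
  have key : ∀ (n : ℕ) (a : PolyR K), (⇑X)^[n] a = 0 → ∃ N : ℕ, X s ^ N * a ∈ S := by
    intro n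
    induction n with
    | zero =>
      intro a ha
      change a = 0 at ha
      exact ⟨0, by rw [ha, mul_zero]; exact S.zero_mem⟩
    | succ n ih =>
      intro a ha
      rw [Function.iterate_succ_apply'] at ha
      set d := (⇑X)^[n] a with hd
      have hc : X ((n.factorial : PolyR K) * X s ^ n) = 0 := by
        simp [hs, Derivation.leibniz_pow]
      obtain ⟨N, hN⟩ := ih ((n.factorial : PolyR K) * X s ^ n * a - d * s ^ n) (by
        rw [iter_sub, iter_mul X hc, iter_mul X ha, iter_pow X hs, ← hd]
        ring)
      refine ⟨N + n, ?_⟩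
      have hXs : X s ∈ S := hS _ hs
      have h1 : X s ^ N * (d * s ^ n) ∈ S :=
        S.mul_mem (S.pow_mem hXs N) (S.mul_mem (hS _ ha) (S.pow_mem hsS n))
      have h2 := S.smul_mem (S.add_mem hN h1) ((n.factorial : K)⁻¹)
      have h3 : (n.factorial : K)⁻¹ • (X s ^ N * ((n.factorial : PolyR K) * X s ^ n * a - d * s ^ n)
          + X s ^ N * (d * s ^ n)) = X s ^ (N + n) * a := by
        have h4 : (n.factorial : PolyR K) = MvPolynomial.C (n.factorial : K) := by simp
        have h5 : MvPolynomial.C (σ := Fin 3) (n.factorial : K)⁻¹ * MvPolynomial.C (n.factorial : K)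
            = 1 := by
          rw [← map_mul, inv_mul_cancel₀ (by exact_mod_cast n.factorial_ne_zero), map_one]
        rw [MvPolynomial.smul_eq_C_mul, h4]
        linear_combination X s ^ (N + n) * a * h5
      rwa [h3] at h2
  obtain ⟨n, _, hn⟩ := hln a
  exact key n a hn

/-- The standing hypotheses. -/
structure Setup {K : Type} [Field K] (X : Derivation K (PolyR K) (PolyR K)) (u p s : PolyR K)
    (c : Polynomial K) : Prop where
  coord : IsCoord K u
  Xu : X u = 0
  Xp : X p = 0
  ker : ∀ a, X a = 0 → ∃ F, E2 u p F = a
  min : IsMinLocalSlice K X s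
  Xs : X s = Polynomial.aeval u c
  inj : Function.Injective (E3 u p s)

theorem Setup.mk' {K : Type} [Field K] [CharZero K] (X : Derivation K (PolyR K) (PolyR K))
    (hln : LND K X) (u p s : PolyR K) (hu : IsCoord K u)
    (hker : {a : PolyR K | X a = 0} = (Algebra.adjoin K {u, p} : Subalgebra K (PolyR K)))
    (hs : IsMinLocalSlice K X s) (c : Polynomial K) (hc : X s = Polynomial.aeval u c) :
    Setup X u p s c := by
  have hk : ∀ a, X a = 0 ↔ a ∈ Algebra.adjoin K {u, p} := fun a => Set.ext_iff.mp hker a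
  refine ⟨hu, (hk u).mpr (Algebra.subset_adjoin (by simp)),
    (hk p).mpr (Algebra.subset_adjoin (by simp)), fun a ha => exists_E2 ((hk a).mp ha), hs, hc, ?_⟩
  apply E3_injective
  have hle : Algebra.adjoin K {u, p} ≤ Algebra.adjoin K {u, p, s} :=
    Algebra.adjoin_mono (by intro x hx; simp at hx ⊢; tauto)
  intro a
  obtain ⟨N, hN⟩ := slice_lemma X hln hs.1.2 (Algebra.adjoin K {u, p, s})
    (fun a ha => hle ((hk a).mp ha)) (Algebra.subset_adjoin (by simp)) a
  exact ⟨X s ^ N, Subalgebra.pow_mem _ (hle ((hk _).mp hs.1.2)) N, pow_ne_zero _ hs.1.1, hN⟩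

theorem der_const_mul {K : Type} [Field K] (X : Derivation K (PolyR K) (PolyR K)) {k : PolyR K}
    (hk : X k = 0) (a : PolyR K) : X (k * a) = k * X a := by
  simp [hk]

theorem Setup.c_ne {K : Type} [Field K] {X : Derivation K (PolyR K) (PolyR K)} {u p s : PolyR K}
    {c : Polynomial K} (S : Setup X u p s c) : c ≠ 0 := by
  rintro rfl
  exact S.min.1.1 (by rw [S.Xs, map_zero])

theorem Setup.min_slice {K : Type} [Field K] {X : Derivation K (PolyR K) (PolyR K)}
    {u p s : PolyR K} {c : Polynomial K} (S : Setup X u p s c) {q : Polynomial K}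
    (hq : Irreducible q) (hqc : q ∣ c) (F : Polynomial (Polynomial K)) :
    ¬ Polynomial.aeval u q ∣ s - E2 u p F := by
  rintro ⟨t, ht⟩
  have hpr := coord_prime u S.coord q hq
  obtain ⟨c', rfl⟩ := hqc
  have h1 : X t = Polynomial.aeval u c' := by
    have h := congrArg X ht
    rw [map_sub, der_E2 X S.Xu, S.Xp, mul_zero, sub_zero, S.Xs,
      der_const_mul X (der_aeval X S.Xu q), map_mul] at h
    exact (mul_left_cancel₀ hpr.ne_zero h).symm
  have hne : Polynomial.aeval u c' ≠ 0 := by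
    intro h0
    apply S.min.1.1
    rw [S.Xs, map_mul, h0, mul_zero]
  obtain ⟨μ, hμ⟩ := S.min.2 t ⟨by rwa [h1], by rw [h1, der_aeval X S.Xu]⟩
    (by rw [h1, S.Xs, map_mul]; exact dvd_mul_left _ _)
  rw [h1, S.Xs, map_mul] at hμ
  apply hpr.not_isUnit
  apply IsUnit.of_mul_eq_one (μ : PolyR K)
  apply mul_right_cancel₀ hne
  linear_combination -hμ

theorem Setup.p_nonconst {K : Type} [Field K] {X : Derivation K (PolyR K) (PolyR K)}
    {u p s : PolyR K} {c : Polynomial K} (S : Setup X u p s c) {q : Polynomial K}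
    (hq : Irreducible q) (a : Polynomial K) :
    ¬ Polynomial.aeval u q ∣ p - Polynomial.aeval u a := by
  rintro ⟨t, ht⟩
  have hpr := coord_prime u S.coord q hq
  have h1 : X t = 0 := by
    have h := congrArg X ht
    rw [map_sub, der_aeval X S.Xu, S.Xp, der_const_mul X (der_aeval X S.Xu q), sub_zero] at h
    exact (mul_eq_zero.mp h.symm).resolve_left hpr.ne_zero
  obtain ⟨F, rfl⟩ := S.ker t h1
  have h2 : E3 u p s (Polynomial.C (Polynomial.X - Polynomial.C a)) =
      E3 u p s (Polynomial.C (Polynomial.C q * F)) := by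
    simp only [E3_C, map_sub, map_mul, E2_C, E2_X, ht]
  have h3 := Polynomial.C_injective (S.inj h2)
  have h4 := congrArg (fun f => f.coeff 1) h3
  simp at h4
  exact hq.not_isUnit (IsUnit.of_mul_eq_one _ h4.symm)

theorem Setup.plinth {K : Type} [Field K] {X : Derivation K (PolyR K) (PolyR K)}
    {u p s : PolyR K} {c : Polynomial K} (S : Setup X u p s c) (v : PolyR K) (hv : X (X v) = 0)
    (g : Polynomial K) : g ∣ c → Polynomial.aeval u g ∣ X v := by
  induction g using WfDvdMonoid.induction_on_irreducible with
  | zero => intro h; exact absurd (zero_dvd_iff.mp h) S.c_ne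
  | unit g hg => intro _; exact (hg.map (Polynomial.aeval u)).dvd
  | mul g q hg hq ih =>
    rintro ⟨c', hc'⟩
    obtain ⟨d, hd⟩ := ih ⟨q * c', by rw [hc']; ring⟩
    have hg0 : Polynomial.aeval u g ≠ 0 := by
      intro h0
      apply S.min.1.1
      rw [S.Xs, hc', map_mul, map_mul, h0, mul_zero, zero_mul]
    have hXd : X d = 0 := by
      have h := congrArg X hd
      rw [hv, der_const_mul X (der_aeval X S.Xu g)] at h
      exact (mul_eq_zero.mp h.symm).resolve_left hg0
    have hW : X (Polynomial.aeval u (q * c') * v - d * s) = 0 := by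
      rw [map_sub, der_const_mul X (der_aeval X S.Xu _), der_const_mul X hXd, hd, S.Xs, hc']
      simp only [map_mul]
      ring
    obtain ⟨D, rfl⟩ := S.ker d hXd
    obtain ⟨G, hG⟩ := S.ker _ hW
    have hqD : Polynomial.aeval u q ∣ E2 u p D := by
      by_contra hnd
      obtain ⟨H, hH⟩ := coord_frac u S.coord q hq p s D G (S.p_nonconst hq) hnd
        ⟨Polynomial.aeval u c' * v, by rw [hG, map_mul]; ring⟩
      exact S.min_slice hq ⟨g * c', by rw [hc']; ring⟩ H hH
    obtain ⟨k, hk⟩ := hqD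
    exact ⟨k, by rw [hd, hk, map_mul]; ring⟩

/-- `s', w` are algebraically independent modulo `q`. -/
theorem indep_mod {K : Type} [Field K] [CharZero K] {X : Derivation K (PolyR K) (PolyR K)}
    {u t w g : PolyR K} (hu : IsCoord K u) (hXu : X u = 0) {q : Polynomial K} (hq : Irreducible q)
    (hXt : Polynomial.aeval u q ∣ X t) (hXw : X w = g) (hg : ¬ Polynomial.aeval u q ∣ g)
    (ht : ∀ a : Polynomial K, ¬ Polynomial.aeval u q ∣ t - Polynomial.aeval u a) :
    ∀ (n : ℕ) (F : Polynomial (Polynomial (Polynomial K))), F.natDegree ≤ n →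
      Polynomial.aeval u q ∣ E3 u t w F → Polynomial.C (Polynomial.C q) ∣ F := by
  have hpr := coord_prime u hu q hq
  have h0 : ∀ f : Polynomial (Polynomial K), Polynomial.aeval u q ∣ E2 u t f →
      Polynomial.C q ∣ f := fun f hf => coord_alg u hu q hq t f hf ht
  intro n
  induction n with
  | zero =>
    intro F hF h
    rw [Polynomial.eq_C_of_natDegree_le_zero hF] at h ⊢
    rw [E3_C] at h
    exact map_dvd Polynomial.C (h0 _ h)
  | succ n ih =>
    intro F hF h
    have h1 : Polynomial.aeval u q ∣ E3 u t w (Polynomial.derivative F) := by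
      have h2 := der_E3 X hXu w _ hXt F
      obtain ⟨k, hk⟩ := h
      have h3 : Polynomial.aeval u q ∣ X (E3 u t w F) := by
        rw [hk, der_const_mul X (der_aeval X hXu q)]
        exact dvd_mul_right _ _
      have h4 := (dvd_sub_right h3).mp h2
      rw [hXw] at h4
      exact (hpr.dvd_or_dvd h4).resolve_right hg
    have h2 := ih _ ((Polynomial.natDegree_derivative_le F).trans (by omega)) h1
    obtain ⟨k, hk⟩ := exists_of_dvd_derivative (Polynomial.C q) F h2
    have h4 : Polynomial.aeval u q ∣ E2 u t (F.coeff 0) := by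
      have h5 := congrArg (E3 u t w) hk
      rw [map_add, map_mul, E3_C, E3_C, E2_C] at h5
      rw [h5] at h
      exact (dvd_add_left (dvd_mul_right _ _)).mp h
    rw [hk]
    exact dvd_add (map_dvd Polynomial.C (h0 _ h4)) (dvd_mul_right _ _)

theorem Setup.backward {K : Type} [Field K] [CharZero K] {X : Derivation K (PolyR K) (PolyR K)}
    (hln : LND K X)
    {u p s : PolyR K} {c : Polynomial K} (S : Setup X u p s c) (Q ℓ : Polynomial (Polynomial K))
    (h : Polynomial.aeval u c ∣ p + E2 u (s + E2 u p ℓ) Q) : Triangulable K X := by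
  obtain ⟨w, hw⟩ := h
  set t := s + E2 u p ℓ with ht
  have hc0 : Polynomial.aeval u c ≠ 0 := by
    rw [← S.Xs]; exact S.min.1.1
  have hXt : X t = Polynomial.aeval u c := by
    rw [ht, map_add, der_E2 X S.Xu, S.Xp, mul_zero, add_zero, S.Xs]
  have hXw : X w = E2 u t (Polynomial.derivative Q) := by
    have h := congrArg X hw
    rw [map_add, S.Xp, der_E2 X S.Xu, hXt, der_const_mul X (der_aeval X S.Xu c)] at h
    apply mul_left_cancel₀ hc0
    linear_combination -h
  have htq : ∀ q, Irreducible q → q ∣ c → ∀ a : Polynomial K,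
      ¬ Polynomial.aeval u q ∣ t - Polynomial.aeval u a := by
    intro q hq hqc a hd
    apply S.min_slice hq hqc (Polynomial.C a - ℓ)
    rw [map_sub, E2_C]
    convert hd using 1
    rw [ht]
    ring
  have hgq : ∀ q, Irreducible q → q ∣ c →
      ¬ Polynomial.aeval u q ∣ E2 u t (Polynomial.derivative Q) := by
    intro q hq hqc hd
    have h1 := coord_alg u S.coord q hq t _ hd (htq q hq hqc)
    obtain ⟨k, hk⟩ := exists_of_dvd_derivative q Q h1
    have h5 := congrArg (E2 u t) hk
    simp only [map_add, map_mul, E2_C] at h5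
    apply S.p_nonconst hq (-(Q.coeff 0))
    obtain ⟨c', rfl⟩ := hqc
    rw [map_mul] at hw
    refine ⟨Polynomial.aeval u c' * w - E2 u t k, ?_⟩
    rw [map_neg]
    linear_combination hw - h5
  set B := Algebra.adjoin K {u, t, w} with hB
  have huB : u ∈ B := Algebra.subset_adjoin (by simp)
  have htB : t ∈ B := Algebra.subset_adjoin (by simp)
  have hwB : w ∈ B := Algebra.subset_adjoin (by simp)
  have hpB : p ∈ B := by
    have : p = Polynomial.aeval u c * w - E2 u t Q := by linear_combination hw
    rw [this]
    exact B.sub_mem (B.mul_mem (aeval_mem_adj B u huB c) hwB) (E2_mem B u t huB htB Q)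
  have hsB : s ∈ B := by
    have : s = t - E2 u p ℓ := by rw [ht]; ring
    rw [this]
    exact B.sub_mem htB (E2_mem B u p huB hpB ℓ)
  have key : ∀ d : Polynomial K, d ≠ 0 → (∀ q, Irreducible q → q ∣ d → q ∣ c) →
      ∀ a, Polynomial.aeval u d * a ∈ B → a ∈ B := by
    intro d
    induction d using WfDvdMonoid.induction_on_irreducible with
    | zero => intro h0; exact absurd rfl h0
    | unit g hg =>
      intro _ _ a ha
      obtain ⟨g', hg'⟩ := hg.exists_left_inv
      have h1 := B.mul_mem (aeval_mem_adj B u huB g') ha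
      rwa [← mul_assoc, ← map_mul, hg', map_one, one_mul] at h1
    | mul g q hg hq ih =>
      intro _ hgc a ha
      apply ih hg (fun r hr hrg => hgc r hr (hrg.mul_left q)) a
      rw [map_mul, mul_assoc] at ha
      obtain ⟨F, hF⟩ := exists_E3 ha
      have hqc := hgc q hq (dvd_mul_right _ _)
      obtain ⟨k, rfl⟩ := indep_mod (X := X) S.coord S.Xu hq
        (by rw [hXt]; exact map_dvd _ hqc) hXw (hgq q hq hqc) (htq q hq hqc) _ F le_rfl
        (by rw [hF]; exact dvd_mul_right _ _)
      rw [map_mul, E3_C, E2_C] at hF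
      rw [← mul_left_cancel₀ (coord_prime u S.coord q hq).ne_zero hF]
      exact E3_mem B u t w huB htB hwB k
  refine ⟨u, t, w, ?_, ?_, ?_, ?_⟩
  · change B = ⊤
    rw [eq_top_iff]
    intro a _
    obtain ⟨N, hN⟩ := slice_lemma X hln S.min.1.2 B
      (fun a ha => by
        obtain ⟨F, rfl⟩ := S.ker a ha
        exact E2_mem B u p huB hpB F) hsB a
    rw [S.Xs, ← map_pow] at hN
    exact key (c ^ N) (pow_ne_zero _ S.c_ne) (fun q hq hd => hq.prime.dvd_of_dvd_pow hd) a hN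
  · rw [S.Xu]; exact zero_mem _
  · rw [hXt]; exact aeval_mem_adj _ u (Algebra.subset_adjoin (by simp)) c
  · rw [hXw]
    exact E2_mem _ u t (Algebra.subset_adjoin (by simp)) (Algebra.subset_adjoin (by simp)) _

theorem dvd_C_const {D : Type} [CommRing D] [IsDomain D] {a : Polynomial D} {b : D} (hb : b ≠ 0)
    (h : a ∣ Polynomial.C b) : ∃ a', a = Polynomial.C a' ∧ a' ∣ b := by
  have h1 := Polynomial.natDegree_le_of_dvd h (by simpa using hb)
  rw [Polynomial.natDegree_C] at h1
  have h2 := Polynomial.eq_C_of_natDegree_le_zero h1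
  refine ⟨_, h2, ?_⟩
  rw [h2, Polynomial.C_dvd_iff_dvd_coeff] at h
  simpa using h 0

theorem dvd_E3 {K : Type} [Field K] {u v w : PolyR K} (h : Algebra.adjoin K {u, v, w} = ⊤)
    {F G : Polynomial (Polynomial (Polynomial K))} (hd : E3 u v w F ∣ E3 u v w G) : F ∣ G := by
  obtain ⟨k, hk⟩ := hd
  obtain ⟨k, rfl⟩ := (E3_bij u v w h).2 k
  rw [← map_mul] at hk
  exact ⟨k, (E3_bij u v w h).1 hk⟩

theorem der_dvd_all {K : Type} [Field K] (X : Derivation K (PolyR K) (PolyR K)) {u v w q : PolyR K}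
    (h : Algebra.adjoin K {u, v, w} = ⊤) (hu : X u = 0) (hv : q ∣ X v) (hw : q ∣ X w)
    (a : PolyR K) : q ∣ X a := by
  obtain ⟨F, rfl⟩ := (E3_bij u v w h).2 a
  have h1 := der_E3 X hu w q hv F
  exact (dvd_sub_left (hw.mul_left _)).mp h1

/-- if `q(u)` divides a nonzero polynomial in the coordinate `u'`, then `u' ∈ K[u]`. -/
theorem coord_eq {K : Type} [Field K] {u u' v' w' : PolyR K} (hu : IsCoord K u)
    (h : Algebra.adjoin K {u', v', w'} = ⊤) {q d : Polynomial K} (hq : Irreducible q)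
    (hd : d ≠ 0) (hqd : Polynomial.aeval u q ∣ Polynomial.aeval u' d) :
    u' ∈ Algebra.adjoin K {u} := by
  obtain ⟨F, hF⟩ := (E3_bij u' v' w' h).2 u
  have hE : E3 u' v' w' (Polynomial.eval₂ (Polynomial.C.comp Polynomial.C) F
      (q.map Polynomial.C)) = Polynomial.aeval u q := by
    rw [Polynomial.hom_eval₂, Polynomial.eval₂_map, hF, Polynomial.aeval_def]
    congr 1
    ext r
    simp
  have h1 : Polynomial.eval₂ (Polynomial.C.comp Polynomial.C) F (q.map Polynomial.C) ∣
      Polynomial.C (Polynomial.C d) := by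
    apply dvd_E3 h
    rw [hE, E3_C, E2_C]
    exact hqd
  obtain ⟨f, hf, hfd⟩ := dvd_C_const (by simpa using hd) h1
  obtain ⟨b, rfl, -⟩ := dvd_C_const hd hfd
  obtain ⟨l, rfl⟩ := alg_const2 (q.map Polynomial.C)
    (by
      rw [Polynomial.natDegree_map_eq_of_injective Polynomial.C_injective]
      exact hq.natDegree_pos.ne') F b hf
  rw [E3_C, E2_C] at hF
  have hl : Polynomial.X ∣ l - Polynomial.C (l.coeff 0) := by
    rw [Polynomial.X_dvd_iff]; simp
  obtain ⟨l1, hl1⟩ := hl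
  have h2 := congrArg (Polynomial.aeval u') hl1
  rw [map_sub, hF, map_mul, Polynomial.aeval_X, Polynomial.aeval_C] at h2
  have hpr := coord_prime u hu (Polynomial.X - Polynomial.C (l.coeff 0))
    (Polynomial.irreducible_X_sub_C _)
  have hpr' := coord_prime u' ⟨v', w', h⟩ Polynomial.X Polynomial.irreducible_X
  rw [Polynomial.aeval_X] at hpr'
  have h3 : Polynomial.aeval u (Polynomial.X - Polynomial.C (l.coeff 0)) =
      u' * Polynomial.aeval u' l1 := by
    rw [← h2]; simp
  have hun := (hpr.irreducible.isUnit_or_isUnit h3).resolve_left hpr'.not_isUnit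
  obtain ⟨r, hr, hr2⟩ := (MvPolynomial.isUnit_iff_eq_C_of_isReduced).mp hun
  have hr0 : r ≠ 0 := hr.ne_zero
  have h4 : u' = Polynomial.aeval u
      (Polynomial.C r⁻¹ * (Polynomial.X - Polynomial.C (l.coeff 0))) := by
    rw [map_mul, h3, hr2, Polynomial.aeval_C]
    have h5 : (algebraMap K (PolyR K) r⁻¹) * MvPolynomial.C r = 1 := by
      rw [MvPolynomial.algebraMap_eq, ← map_mul, inv_mul_cancel₀ hr0, map_one]
    linear_combination -u' * h5
  rw [h4]
  exact aeval_mem_adj _ u (Algebra.subset_adjoin (by simp)) _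

theorem core_mod {K : Type} [Field K] [CharZero K] {X : Derivation K (PolyR K) (PolyR K)}
    {u v w : PolyR K} (h : Algebra.adjoin K {u, v, w} = ⊤) (hu : X u = 0) {q : Polynomial K}
    (hq : Irreducible q) (hw : ¬ Polynomial.aeval u q ∣ X w) (m : ℕ)
    (hv : Polynomial.aeval u (q ^ m) ∣ X v) (a : PolyR K)
    (ha : Polynomial.aeval u (q ^ m) ∣ X a) :
    ∃ S0, Polynomial.aeval u (q ^ m) ∣ a - E2 u v S0 := by
  have hpr := coord_prime u ⟨v, w, h⟩ q hq
  obtain ⟨F, rfl⟩ := (E3_bij u v w h).2 a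
  have h1 := (dvd_sub_right ha).mp (der_E3 X hu w _ hv F)
  rw [map_pow] at h1
  have h2 := hpr.pow_dvd_of_dvd_mul_right m hw h1
  have h3 : Polynomial.C (Polynomial.C (q ^ m)) ∣ Polynomial.derivative F := by
    apply dvd_E3 h
    rw [E3_C, E2_C, map_pow]
    exact h2
  obtain ⟨k, hk⟩ := exists_of_dvd_derivative _ F h3
  have h4 := congrArg (E3 u v w) hk
  rw [map_add, map_mul, E3_C, E3_C, E2_C] at h4
  exact ⟨F.coeff 0, E3 u v w k, by rw [h4]; ring⟩

theorem E2_congr {K : Type} [Field K] {u v v' m : PolyR K} (h : m ∣ v - v')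
    (F : Polynomial (Polynomial K)) : m ∣ E2 u v F - E2 u v' F := by
  refine h.trans ?_
  simp only [E2, Polynomial.coe_eval₂RingHom]
  rw [Polynomial.eval₂_eq_eval_map, Polynomial.eval₂_eq_eval_map]
  exact Polynomial.sub_dvd_eval_sub _ _ _

theorem Setup.not_unit_c {K : Type} [Field K] {X : Derivation K (PolyR K) (PolyR K)}
    {u p s : PolyR K} {c : Polynomial K} (S : Setup X u p s c) {q : Polynomial K}
    (hq : Irreducible q) (hqc : q ∣ c) (v : PolyR K) (hv : X (X v) = 0) : ¬ IsUnit (X v) := by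
  intro h
  exact (coord_prime u S.coord q hq).not_isUnit
    (isUnit_of_dvd_unit (S.plinth v hv q hqc) h)

theorem Setup.forward {K : Type} [Field K] [CharZero K] {X : Derivation K (PolyR K) (PolyR K)}
    (hirr : IrredDer K X)
    {u p s : PolyR K} {c : Polynomial K} (S : Setup X u p s c) (hT : Triangulable K X)
    {q : Polynomial K} (hq : Irreducible q) {n : ℕ} (hn : 0 < n) (hqc : q ^ n ∣ c) :
    ∃ Q ℓ : Polynomial (Polynomial K),
      Polynomial.aeval u (q ^ n) ∣ p + E2 u (s + E2 u p ℓ) Q := by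
  obtain ⟨u', v, w, hcs, hXu', hXv', hXw'⟩ := hT
  change Algebra.adjoin K {u', v, w} = ⊤ at hcs
  have hqc1 : q ∣ c := (dvd_pow_self q hn.ne').trans hqc
  have hpr := coord_prime u S.coord q hq
  have hXu0 : X u' = 0 := by
    obtain ⟨κ, hκ⟩ := Algebra.mem_bot.mp hXu'
    by_contra hne
    apply S.not_unit_c hq hqc1 u'
    · rw [← hκ, Derivation.map_algebraMap]
    · rw [← hκ]
      have : κ ≠ 0 := by
        rintro rfl
        rw [map_zero] at hκ
        exact hne hκ.symm
      exact (IsUnit.mk0 κ this).map _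
  obtain ⟨d', hd'⟩ := exists_aeval hXv'
  obtain ⟨g', hg'⟩ := exists_E2 hXw'
  have hd0 : d' ≠ 0 := by
    rintro rfl
    rw [map_zero] at hd'
    apply S.not_unit_c hq hqc1 w
    · rw [← hg', der_E2 X hXu0, ← hd', mul_zero]
    · apply hirr
      intro i
      exact der_dvd_all X hcs hXu0 (by rw [← hd']; exact dvd_zero _) dvd_rfl _
  have hXXv : X (X v) = 0 := by
    rw [← hd', der_aeval X hXu0]
  have hcv := S.plinth v hXXv
  have hu'u : u' ∈ Algebra.adjoin K {u} :=
    coord_eq S.coord hcs hq hd0 (by rw [hd']; exact hcv q hqc1)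
  -- replace `u'` by `u`
  have hcs2 : Algebra.adjoin K {u, v, w} = ⊤ := by
    rw [eq_top_iff, ← hcs]
    apply Algebra.adjoin_le
    intro x hx
    rcases hx with rfl | rfl | hx
    · exact Algebra.adjoin_mono (by simp) hu'u
    · exact Algebra.subset_adjoin (by simp)
    · rw [Set.mem_singleton_iff] at hx
      subst hx
      exact Algebra.subset_adjoin (by simp)
  obtain ⟨d, hd⟩ : ∃ d, Polynomial.aeval u d = X v := by
    apply exists_aeval
    rw [← hd']
    exact aeval_mem_adj _ u' hu'u d'
  have hdc : c ∣ d := by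
    have hd1 : d ≠ 0 := by
      rintro rfl
      rw [map_zero] at hd
      rw [← hd] at hd'
      have h1 : E3 u' v w (Polynomial.C (Polynomial.C d')) = E3 u' v w 0 := by
        simp [hd']
      have h2 := (E3_bij u' v w hcs).1 h1
      simp at h2
      exact hd0 h2
    have h1 : Polynomial.C (Polynomial.C c) ∣ Polynomial.C (Polynomial.C d) := by
      apply dvd_E3 hcs2
      rw [E3_C, E3_C, E2_C, E2_C, hd]
      exact hcv c dvd_rfl
    rw [Polynomial.C_dvd_iff_dvd_coeff] at h1
    have h2 := h1 0
    rw [Polynomial.coeff_C_zero, Polynomial.C_dvd_iff_dvd_coeff] at h2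
    simpa using h2 0
  obtain ⟨e, rfl⟩ := hdc
  have hW : X (v - Polynomial.aeval u e * s) = 0 := by
    rw [map_sub, der_const_mul X (der_aeval X S.Xu e), S.Xs, ← hd, map_mul]
    ring
  obtain ⟨f, hf⟩ := S.ker _ hW
  have hqw : ¬ Polynomial.aeval u q ∣ X w := by
    intro hdw
    apply hpr.not_isUnit
    apply hirr
    intro i
    exact der_dvd_all X hcs2 S.Xu (hcv q hqc1) hdw _
  have hqe : ¬ q ∣ e := by
    rintro ⟨e', rfl⟩
    obtain ⟨S0, hS0⟩ := core_mod hcs2 S.Xu hq hqw 1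
      (by rw [pow_one]; exact hcv q hqc1) s (by rw [pow_one, S.Xs]; exact map_dvd _ hqc1)
    rw [pow_one] at hS0
    apply S.min_slice hq hqc1 (S0.comp f)
    rw [E2_comp]
    have h1 : Polynomial.aeval u q ∣ v - E2 u p f := by
      rw [hf, map_mul]
      exact ⟨Polynomial.aeval u e' * s, by ring⟩
    have h2 := dvd_add hS0 (E2_congr (u := u) h1 S0)
    convert h2 using 1
    ring
  obtain ⟨S0, hS0⟩ := core_mod hcs2 S.Xu hq hqw n (hcv _ hqc) p (by rw [S.Xp]; exact dvd_zero _)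
  have hcop : IsCoprime e (q ^ n) := by
    apply IsCoprime.pow_right
    exact ((hq.coprime_iff_not_dvd).mpr hqe).symm
  obtain ⟨e1, b, hb⟩ := hcop
  refine ⟨-(S0.comp (Polynomial.C e * Polynomial.X)), Polynomial.C e1 * f, ?_⟩
  rw [map_neg, E2_comp, map_mul, map_mul, E2_C, E2_C, E2_X]
  have hv2 : Polynomial.aeval u (q ^ n) ∣
      v - Polynomial.aeval u e * (s + Polynomial.aeval u e1 * E2 u p f) := by
    refine ⟨Polynomial.aeval u b * E2 u p f, ?_⟩
    have h1 := congrArg (Polynomial.aeval u) hb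
    simp only [map_add, map_mul, map_one] at h1
    linear_combination (-E2 u p f) * h1 - hf
  have h2 := dvd_add hS0 (E2_congr (u := u) hv2 S0)
  convert h2 using 1
  ring

/-- Chinese remaindering of the local conditions. -/
theorem crt_poly {K : Type} [Field K] {r : ℕ} (m : Fin r → Polynomial K)
    (hm : Pairwise fun i j => IsCoprime (m i) (m j)) (Q : Fin r → Polynomial (Polynomial K)) :
    ∃ P : Polynomial (Polynomial K), ∀ i, Polynomial.C (m i) ∣ P - Q i := by
  classical
  have h : ∀ i, ∃ e : Polynomial K, m i ∣ e - 1 ∧ ∀ j, j ≠ i → m j ∣ e := by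
    intro i
    have hc : IsCoprime (m i) (∏ j ∈ Finset.univ.erase i, m j) := by
      apply IsCoprime.prod_right
      intro j hj
      exact hm (Finset.ne_of_mem_erase hj).symm
    obtain ⟨a, b, hab⟩ := hc
    refine ⟨b * ∏ j ∈ Finset.univ.erase i, m j, ⟨-a, by linear_combination hab⟩, ?_⟩
    intro j hj
    exact (Finset.dvd_prod_of_mem m (Finset.mem_erase.mpr ⟨hj, Finset.mem_univ _⟩)).mul_left b
  choose e he1 he2 using h
  refine ⟨∑ j, Polynomial.C (e j) * Q j, fun i => ?_⟩
  rw [← Finset.add_sum_erase _ _ (Finset.mem_univ i)]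
  have h1 : Polynomial.C (m i) ∣ ∑ j ∈ Finset.univ.erase i, Polynomial.C (e j) * Q j := by
    apply Finset.dvd_sum
    intro j hj
    exact (map_dvd Polynomial.C (he2 j i (Finset.ne_of_mem_erase hj).symm)).mul_right _
  have h2 : Polynomial.C (m i) ∣ Polynomial.C (e i - 1) * Q i :=
    (map_dvd Polynomial.C (he1 i)).mul_right _
  have h3 := dvd_add h1 h2
  convert h3 using 1
  rw [map_sub, map_one]
  ring

/-- Primary reduction of the triangulability criterion: with
`X s = c(u) = c₁^{n₁} ⋯ c_r^{n_r}`, `X` is triangulable iff for every `i` the ideal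
`I_{cᵢ^{nᵢ}}^X` contains a polynomial `Hᵢ ≡ p + Qᵢ(u, s + ℓᵢ(u,p)) mod cᵢ^{nᵢ}`. -/
theorem triangulability_primary_reduction {K : Type} [Field K] [CharZero K]
    (X : Derivation K (PolyR K) (PolyR K))
    (hln : LND K X) (hirr : IrredDer K X) (hrk : rankD K X = 2)
    (u p : PolyR K) (hu : IsCoord K u)
    (hker : {a : PolyR K | X a = 0} = (Algebra.adjoin K {u, p} : Subalgebra K (PolyR K)))
    (s : PolyR K) (hs : IsMinLocalSlice K X s)
    (r : ℕ) (ci : Fin r → Polynomial K) (ni : Fin r → ℕ)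
    (hci : ∀ i, Irreducible (ci i)) (hni : ∀ i, 0 < ni i)
    (hpair : ∀ i j, i ≠ j → ¬ Associated (ci i) (ci j))
    (hc : X s = Polynomial.aeval u (∏ i : Fin r, ci i ^ ni i)) :
    Triangulable K X ↔
      ∀ i : Fin r, ∃ H : PolyR K,
        (Polynomial.aeval u (ci i ^ ni i) ∣ H ∧ H ∈ Algebra.adjoin K {u, p, s}) ∧
        ∃ Q ℓ : Polynomial (Polynomial K),
          Polynomial.aeval u (ci i ^ ni i) ∣
            (H - (p + ev2 K u (s + ev2 K u p ℓ) Q)) := by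
  have S := Setup.mk' X hln u p s hu hker hs _ hc
  constructor
  · intro hT i
    obtain ⟨Q, ℓ, h⟩ := S.forward hirr hT (hci i) (hni i)
      (Finset.dvd_prod_of_mem (fun i => ci i ^ ni i) (Finset.mem_univ i))
    refine ⟨0, ⟨dvd_zero _, zero_mem _⟩, Q, ℓ, ?_⟩
    rw [zero_sub, dvd_neg]
    exact h
  · intro h
    have h' : ∀ i, ∃ Q ℓ : Polynomial (Polynomial K),
        Polynomial.aeval u (ci i ^ ni i) ∣ p + E2 u (s + E2 u p ℓ) Q := by
      intro i
      obtain ⟨H, ⟨hH, -⟩, Q, ℓ, hd⟩ := h i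
      exact ⟨Q, ℓ, (dvd_sub_right hH).mp hd⟩
    choose Q ℓ hQ using h'
    have hcop : Pairwise fun i j => IsCoprime (ci i ^ ni i) (ci j ^ ni j) := by
      intro i j hij
      apply IsCoprime.pow
      rw [(hci i).coprime_iff_not_dvd]
      intro hd
      exact hpair i j hij ((hci i).associated_of_dvd (hci j) hd)
    obtain ⟨Q', hQ'⟩ := crt_poly _ hcop Q
    obtain ⟨ℓ', hℓ'⟩ := crt_poly _ hcop ℓ
    apply S.backward hln Q' ℓ'
    rw [map_prod]
    apply Finset.prod_dvd_of_coprime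
    · intro i _ j _ hij
      exact (hcop hij).map (Polynomial.aeval u).toRingHom
    · intro i _
      have h1 := map_dvd (E2 u p) (hℓ' i)
      have h2 := map_dvd (E2 u (s + E2 u p ℓ')) (hQ' i)
      rw [E2_C, map_sub] at h1 h2
      have h3 : Polynomial.aeval u (ci i ^ ni i) ∣ (s + E2 u p ℓ') - (s + E2 u p (ℓ i)) := by
        convert h1 using 1
        ring
      have h4 := E2_congr (u := u) h3 (Q i)
      have h5 := dvd_add (dvd_add h2 h4) (hQ i)
      convert h5 using 1
      ring

end
end

section
/- Let K be a field of characteristic zero and X a rank-two irreducible locally nilpotent K-derivation of K[x,y,z]. Write K[x,y,z]^X = K[u,p] where u is a coordinate of K[x,y,z], let s be a minimal local slice of X with X(s) = c(u), and let c1 be a prime factor of c in K[u]. Then there exists a polynomial h1 ∈ K[u,p,s], monic as a polynomial in s, such that the ideal I_{c1}^X = c1·K[x,y,z] ∩ K[u,p,s] is generated by c1 and h1; moreover the residue of h1 in (K[u]/(c1))[p,s] is irreducible and is unique up to multiplication by a nonzero element of the field K[u]/(c1). -/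
set_option synthInstance.maxHeartbeats 1000000
set_option maxHeartbeats 1000000

noncomputable section

variable (K : Type) [Field K] [CharZero K]

section Helpers
open Polynomial

def Th2 {A E : Type} [CommRing A] [CommRing E] (f : A →+* E) (a b : E) : A[X][X] →+* E :=
  eval₂RingHom (eval₂RingHom f a) b

theorem Th2_CC {A E : Type} [CommRing A] [CommRing E] (f : A →+* E) (a b : E) (r : A) :
    Th2 f a b (C (C r)) = f r := by simp [Th2]

theorem Th2_CX {A E : Type} [CommRing A] [CommRing E] (f : A →+* E) (a b : E) :
    Th2 f a b (C X) = a := by simp [Th2]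

theorem Th2_X {A E : Type} [CommRing A] [CommRing E] (f : A →+* E) (a b : E) :
    Th2 f a b X = b := by simp [Th2]

theorem Th2_C {A E : Type} [CommRing A] [CommRing E] (f : A →+* E) (a b : E) (r : A[X]) :
    Th2 f a b (C r) = eval₂ f a r := by simp [Th2]

def iota3 (F : Type) [Field F] : MvPolynomial (Fin 3) F ≃+* F[X][X][X] :=
  RingEquiv.ofRingHom
    (MvPolynomial.eval₂Hom (R := F) (S₁ := F[X][X][X]) (C.comp (C.comp C)) ![C (C X), C X, X] :
      MvPolynomial (Fin 3) F →+* F[X][X][X])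
    (Th2 (aeval (MvPolynomial.X 0 : MvPolynomial (Fin 3) F)).toRingHom
      (MvPolynomial.X 1) (MvPolynomial.X 2))
    (by
      ext <;> simp [Th2])
    (by
      apply MvPolynomial.ringHom_ext
      · intro r
        simp [Th2]
      · intro i
        fin_cases i <;> simp [Th2])

def iota2 (F : Type) [Field F] : MvPolynomial (Fin 2) F ≃+* F[X][X] :=
  RingEquiv.ofRingHom
    (MvPolynomial.eval₂Hom (C.comp C) ![C X, X] :
      MvPolynomial (Fin 2) F →+* F[X][X])
    (Th2 MvPolynomial.C
      (MvPolynomial.X 0) (MvPolynomial.X 1))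
    (by
      ext <;> simp [Th2])
    (by
      apply MvPolynomial.ringHom_ext
      · intro r
        simp [Th2]
      · intro i
        fin_cases i <;> simp [Th2])

theorem Th2_iota3 {F R : Type} [Field F] [CommRing R] [Algebra F R] (u a b : R)
    (G : MvPolynomial (Fin 3) F) :
    Th2 (aeval u).toRingHom a b (iota3 F G) = MvPolynomial.aeval ![u, a, b] G := by
  have : (Th2 (aeval u : F[X] →ₐ[F] R).toRingHom a b).comp (iota3 F).toRingHom
      = (MvPolynomial.aeval ![u, a, b] : MvPolynomial (Fin 3) F →ₐ[F] R).toRingHom := by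
    apply MvPolynomial.ringHom_ext
    · intro r
      simp [Th2, iota3]
    · intro i
      fin_cases i <;> simp [Th2, iota3]
  exact congrArg (fun f => f G) this

theorem Th2_iota2 {F R : Type} [Field F] [CommRing R] [Algebra F R] (a b : R)
    (G : MvPolynomial (Fin 2) F) :
    Th2 (algebraMap F R) a b (iota2 F G) = MvPolynomial.aeval ![a, b] G := by
  have : (Th2 (algebraMap F R) a b).comp (iota2 F).toRingHom
      = (MvPolynomial.aeval ![a, b] : MvPolynomial (Fin 2) F →ₐ[F] R).toRingHom := by
    apply MvPolynomial.ringHom_ext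
    · intro r
      simp [Th2, iota2]
    · intro i
      fin_cases i <;> simp [Th2, iota2]
  exact congrArg (fun f => f G) this

theorem range3 {R : Type} (u a b : R) : Set.range ![u, a, b] = {u, a, b} := by
  ext x; simp [eq_comm]; tauto

theorem range2 {R : Type} (a b : R) : Set.range ![a, b] = {a, b} := by
  ext x; simp [eq_comm]; tauto

theorem mem_adjoin3 {F R : Type} [Field F] [CommRing R] [Algebra F R] (u a b : R) (x : R) :
    x ∈ Algebra.adjoin F {u, a, b} ↔ ∃ G : F[X][X][X], Th2 (aeval u).toRingHom a b G = x := by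
  rw [← range3, Algebra.adjoin_range_eq_range_aeval]
  constructor
  · rintro ⟨G, rfl⟩
    exact ⟨iota3 F G, Th2_iota3 u a b G⟩
  · rintro ⟨G, rfl⟩
    refine ⟨(iota3 F).symm G, ?_⟩
    have := Th2_iota3 u a b ((iota3 F).symm G)
    rw [RingEquiv.apply_symm_apply] at this
    exact this.symm

theorem mem_adjoin2 {F R : Type} [Field F] [CommRing R] [Algebra F R] (u a : R) (x : R) :
    x ∈ Algebra.adjoin F {u, a} ↔ ∃ G : F[X][X], eval₂ (aeval u).toRingHom a G = x := by
  constructor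
  · intro h
    induction h using Algebra.adjoin_induction with
    | mem x hx =>
      rcases hx with rfl | rfl
      · exact ⟨C X, by simp⟩
      · exact ⟨X, by simp⟩
    | algebraMap r => exact ⟨C (C r), by simp⟩
    | add x y _ _ hx hy =>
      obtain ⟨G, rfl⟩ := hx
      obtain ⟨H, rfl⟩ := hy
      exact ⟨G + H, by simp⟩
    | mul x y _ _ hx hy =>
      obtain ⟨G, rfl⟩ := hx
      obtain ⟨H, rfl⟩ := hy
      exact ⟨G * H, by simp [eval₂_mul]⟩
  · rintro ⟨G, rfl⟩
    rw [eval₂_eq_sum_range]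
    refine sum_mem fun i _ => mul_mem ?_ (pow_mem (Algebra.subset_adjoin (by simp)) _)
    have : aeval u (G.coeff i) ∈ Algebra.adjoin F {u} := aeval_mem_adjoin_singleton F u
    exact Algebra.adjoin_mono (by simp) this

theorem Th2_inj3 {F : Type} [Field F] (u a b : MvPolynomial (Fin 3) F)
    (h : Algebra.IsAlgebraic (Algebra.adjoin F {u, a, b}) (MvPolynomial (Fin 3) F)) :
    Function.Injective (Th2 (aeval u : F[X] →ₐ[F] _).toRingHom a b) := by
  rw [← range3] at h
  have hb : IsTranscendenceBasis F ![u, a, b] := by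
    apply Algebra.IsAlgebraic.isTranscendenceBasis_of_le_trdeg_of_finite
    rw [MvPolynomial.trdeg_of_isDomain]
    simp
  have hi : Function.Injective (MvPolynomial.aeval ![u, a, b] :
    MvPolynomial (Fin 3) F →ₐ[F] MvPolynomial (Fin 3) F) := hb.1
  intro G H hGH
  apply (iota3 F).symm.injective
  apply hi
  rw [← Th2_iota3, ← Th2_iota3]
  simpa using hGH

theorem alg_of_inj2 {L : Type} [Field L] (a b : L[X][X])
    (h : Function.Injective (Th2 (C.comp C : L →+* L[X][X]) a b)) (e : L[X][X]) :
    ∃ G : L[X][X][X], G ≠ 0 ∧ eval₂ (Th2 (C.comp C : L →+* L[X][X]) a b) e G = 0 := by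
  have hC : (C.comp C : L →+* L[X][X]) = algebraMap L L[X][X] := rfl
  have hi : AlgebraicIndependent L ![a, b] := by
    intro G H hGH
    apply (iota2 L).injective
    apply h
    rw [hC, Th2_iota2, Th2_iota2]
    exact hGH
  have htr : Algebra.trdeg L L[X][X] = 2 := by
    rw [← trdeg_add_eq L L[X], Polynomial.trdeg_of_isDomain, Polynomial.trdeg_of_isDomain]
    norm_num
  have hb : IsTranscendenceBasis L ![a, b] := by
    apply hi.isTranscendenceBasis_of_trdeg_le_of_finite
    rw [htr]; simp
  have halg := hb.isAlgebraic
  obtain ⟨G, hG0, hG⟩ := halg.1 e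
  -- replace coefficients
  let g : L[X][X] →+* Algebra.adjoin L (Set.range ![a, b]) :=
    (Th2 (C.comp C : L →+* L[X][X]) a b).codRestrict (Algebra.adjoin L (Set.range ![a, b])) (by
      intro x
      rw [Algebra.adjoin_range_eq_range_aeval]
      refine ⟨(iota2 L).symm x, ?_⟩
      have := Th2_iota2 (F := L) a b ((iota2 L).symm x)
      rw [RingEquiv.apply_symm_apply] at this
      exact this.symm)
  have hgs : Function.Surjective g := by
    rintro ⟨x, hx⟩
    have hx' := hx
    rw [Algebra.adjoin_range_eq_range_aeval] at hx'
    obtain ⟨G, rfl⟩ := hx'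
    refine ⟨iota2 L G, Subtype.ext ?_⟩
    exact Th2_iota2 a b G
  obtain ⟨G', rfl⟩ := Polynomial.map_surjective g hgs G
  refine ⟨G', ?_, ?_⟩
  · rintro rfl
    simp at hG0
  · rw [aeval_def, eval₂_map] at hG
    exact hG

theorem deriv_zero_aux {A E : Type} [CommRing A] [CommRing E] [IsDomain E] [CharZero E]
    (f : A →+* E) (hf : Function.Injective f) (D : E → E)
    (hadd : ∀ x y, D (x + y) = D x + D y) (hmul : ∀ x y, D (x * y) = x * D y + y * D x)
    (hDf : ∀ a, D (f a) = 0) (e : E) :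
    ∀ (n : ℕ) (G : A[X]), G.natDegree = n → G ≠ 0 → eval₂ f e G = 0 → D e = 0 := by
  let _ := f.toAlgebra
  have : IsDomain A := hf.isDomain f
  have : CharZero A := ⟨fun a b h => by
    have := congrArg f h
    simpa using this⟩
  let D' : Derivation A E E := Derivation.mk' ⟨⟨D, hadd⟩, by
    intro m x
    simp only [Algebra.smul_def, RingHom.id_apply]
    rw [hmul]
    have : D (algebraMap A E m) = 0 := hDf m
    rw [this]; ring⟩ (by
    intro a b
    exact hmul a b)
  have hD' : ∀ x, D' x = D x := fun x => rfl
  intro n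
  induction n using Nat.strong_induction_on with
  | _ n ih =>
    intro G hn hG0 hG
    have hG1 : aeval e G = 0 := hG
    have h1 := D'.map_aeval G e
    rw [hG1, map_zero, smul_eq_mul, eq_comm, mul_eq_zero] at h1
    rcases h1 with h1 | h1
    · by_cases h0 : G.natDegree = 0
      · exfalso
        obtain ⟨a, rfl⟩ := natDegree_eq_zero.1 h0
        rw [eval₂_C] at hG
        apply hG0
        rw [hf (hG.trans f.map_zero.symm), C_0]
      · have hd : derivative G ≠ 0 := by
          intro h
          exact h0 (derivative_eq_zero.1 h)
        exact ih _ (hn ▸ natDegree_derivative_lt h0) _ rfl hd h1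
    · exact h1

theorem key_min {L E : Type} [Field L] [CommRing E] [IsDomain E]
    (f : L[X] →+* E) (hf : Function.Injective f) (s : E) (hs : f.IsIntegralElem s) :
    ∃ m : L[X][X], m.Monic ∧ Irreducible m ∧ ∀ G : L[X][X], eval₂ f s G = 0 ↔ m ∣ G := by
  let _ := f.toAlgebra
  have : Module.IsTorsionFree L[X] E := by
    have : FaithfulSMul L[X] E := (faithfulSMul_iff_algebraMap_injective _ _).2 hf
    infer_instance
  have hs' : IsIntegral L[X] s := hs
  exact ⟨minpoly L[X] s, minpoly.monic hs', minpoly.irreducible hs',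
    fun G => minpoly.isIntegrallyClosed_dvd_iff hs' G⟩

/-- everything in `L[t]` is integral over `L[q]`, `q` nonconstant -/
theorem integral_over {L : Type} [Field L] (q : L[X]) (hq : q.natDegree ≠ 0) (g : L[X]) :
    (aeval q : L[X] →ₐ[L] L[X]).toRingHom.IsIntegralElem g := by
  set f := (aeval q : L[X] →ₐ[L] L[X]).toRingHom with hf
  have hX : f.IsIntegralElem X := by
    have hlc : q.leadingCoeff ≠ 0 := by
      intro h
      rw [leadingCoeff_eq_zero] at h
      simp [h] at hq
    let q1 : L[X] := C q.leadingCoeff⁻¹ * q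
    have hq1 : q1.Monic := by
      show (C q.leadingCoeff⁻¹ * q).Monic
      rw [mul_comm]
      exact monic_mul_leadingCoeff_inv (by intro h; simp [h] at hq)
    have hd : q1.natDegree = q.natDegree := natDegree_C_mul (inv_ne_zero hlc)
    refine ⟨q1.map C - C (C q.leadingCoeff⁻¹ * X), ?_, ?_⟩
    · apply (hq1.map C).sub_of_left
      refine lt_of_le_of_lt degree_C_le ?_
      rw [degree_map_eq_of_injective C_injective]
      apply natDegree_pos_iff_degree_pos.1
      omega
    · rw [eval₂_sub, eval₂_map, eval₂_C]
      have : f.comp C = C := by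
        ext r; simp [hf]
      rw [this]
      simp [q1, hf]
  have hC : ∀ r, f.IsIntegralElem (C r) := fun r => by
    have := f.isIntegralElem_map (x := C r)
    simpa [hf] using this
  induction g using Polynomial.induction_on' with
  | add p q hp hq => exact hp.add f hq
  | monomial n r =>
    rw [← C_mul_X_pow_eq_monomial]
    apply (hC r).mul f
    induction n with
    | zero => simpa using hC 1
    | succ n ih => rw [pow_succ]; exact ih.mul f hX

theorem exists_line {L : Type} [Field L] [CharZero L] (a : L[X][X])
    (ha : ∀ l : L, a ≠ C (C l)) :
    ∃ φ : L[X][X] →+* L[X], (∀ l, φ (C (C l)) = C l) ∧ (φ a).natDegree ≠ 0 := by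
  by_cases h : a.natDegree = 0
  · obtain ⟨b, rfl⟩ := natDegree_eq_zero.1 h
    refine ⟨evalRingHom 0, by simp, ?_⟩
    simp only [coe_evalRingHom, eval_C]
    intro h0
    obtain ⟨l, rfl⟩ := natDegree_eq_zero.1 h0
    exact ha l rfl
  · have h0 : a.leadingCoeff ≠ 0 := by
      intro h'
      rw [leadingCoeff_eq_zero] at h'
      simp [h'] at h
    obtain ⟨α, hα⟩ := exists_eval_ne_zero_of_natDegree_lt_card a.leadingCoeff h0
      (lt_of_lt_of_le (Cardinal.natCast_lt_aleph0) (Cardinal.aleph0_le_mk L))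
    refine ⟨mapRingHom (evalRingHom α), by simp, ?_⟩
    rw [coe_mapRingHom, natDegree_map_of_leadingCoeff_ne_zero _ hα]
    exact h

theorem integral_main {L : Type} [Field L] [CharZero L] (a b : L[X][X])
    (hinj : Function.Injective (eval₂RingHom (C.comp C : L →+* L[X][X]) a))
    (hdep : ¬ Function.Injective (Th2 (C.comp C : L →+* L[X][X]) a b)) :
    (eval₂RingHom (C.comp C : L →+* L[X][X]) a).IsIntegralElem b := by
  set f := eval₂RingHom (C.comp C : L →+* L[X][X]) a with hf
  obtain ⟨φ, hφC, hφ⟩ := exists_line a (by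
    rintro l rfl
    have : f X = f (C l) := by simp [hf]
    exact X_ne_C l (hinj this))
  have hcomp : φ.comp f = (aeval (φ a) : L[X] →ₐ[L] L[X]).toRingHom := by
    ext r
    · simp [hf, hφC]
    · simp [hf]
  obtain ⟨m, hm, hm0⟩ := integral_over (φ a) hφ (φ b)
  refine ⟨m, hm, ?_⟩
  rw [← hcomp, ← hom_eval₂] at hm0
  by_contra he
  have halg : ∃ g : L[X], g ≠ 0 ∧ eval₂ f b m ∣ f g := by
    clear_value f
    have hd : ∃ G : L[X][X], G ≠ 0 ∧ eval₂ f b G = 0 := by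
      by_contra hcon
      push Not at hcon
      apply hdep
      rw [injective_iff_map_eq_zero]
      intro G hG
      by_contra hG0
      apply hcon G hG0
      rw [hf]
      exact hG
    have gen : ∀ {A E : Type} [CommRing A] [IsDomain A] [CommRing E] [IsDomain E] (f : A →+* E)
        (b : E) (G m : A[X]), G ≠ 0 → eval₂ f b G = 0 → eval₂ f b m ≠ 0 →
        ∃ g : A, g ≠ 0 ∧ eval₂ f b m ∣ f g := by
      intro A E _ _ _ _ f b G m hG0 hG hm
      let _ := f.toAlgebra
      have hb : IsAlgebraic A b := ⟨G, hG0, hG⟩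
      have hmb : IsAlgebraic A (aeval b m) := by
        rw [aeval_eq_sum_range]
        refine Subalgebra.sum_mem (Subalgebra.algebraicClosure A E) fun i _ => ?_
        show IsAlgebraic A _
        rw [Algebra.smul_def]
        exact (isAlgebraic_algebraMap _).mul (hb.pow i)
      exact hmb.exists_nonzero_dvd (mem_nonZeroDivisors_of_ne_zero hm)
    obtain ⟨G, hG0, hG⟩ := hd
    exact gen f b G m hG0 hG he
  obtain ⟨g, hg0, e', he'⟩ := halg
  have h1 : φ.comp f g = 0 := by
    rw [RingHom.comp_apply, he', map_mul, hm0, zero_mul]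
  rw [hcomp] at h1
  have h2 : g.comp (φ a) = 0 := h1
  rw [comp_eq_zero_iff] at h2
  rcases h2 with h2 | ⟨_, h2⟩
  · exact hg0 h2
  · apply hφ
    rw [h2, natDegree_C]

theorem slice_aux {K : Type} [Field K] [CharZero K]
    (D : Derivation K (PolyR K) (PolyR K)) (u p s : PolyR K)
    (hk : ∀ a, D a = 0 ↔ a ∈ Algebra.adjoin K {u, p}) (c : K[X]) (hc : D s = aeval u c) :
    ∀ (n : ℕ) (a : PolyR K), (⇑D)^[n] a = 0 →
      ∃ m : ℕ, (aeval u c) ^ m * a ∈ Algebra.adjoin K {u, p, s} := by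
  have hcD : ∀ r : K[X], D (aeval u r) = 0 := fun r =>
    (hk _).2 (Algebra.adjoin_mono (by simp) (aeval_mem_adjoin_singleton K u))
  have hsub : ∀ a, D a = 0 → a ∈ Algebra.adjoin K {u, p, s} := fun a ha =>
    Algebra.adjoin_mono (by
      intro x hx
      rcases hx with rfl | rfl <;> simp) ((hk a).1 ha)
  have hanti : ∀ b ∈ Algebra.adjoin K {u, p, s}, ∃ g ∈ Algebra.adjoin K {u, p, s},
      D g = aeval u c * b := by
    intro b hb
    obtain ⟨G, rfl⟩ := (mem_adjoin3 u p s b).1 hb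
    clear hb
    induction G using Polynomial.induction_on' with
    | add G H hG hH =>
      obtain ⟨g, hg, hg'⟩ := hG
      obtain ⟨h, hh, hh'⟩ := hH
      exact ⟨g + h, add_mem hg hh, by rw [map_add, map_add, hg', hh']; ring⟩
    | monomial n k =>
      have hkk : D (eval₂ (aeval u).toRingHom p k) = 0 := (hk _).2 ((mem_adjoin2 u p _).2 ⟨k, rfl⟩)
      refine ⟨((n : K) + 1)⁻¹ • (eval₂ (aeval u).toRingHom p k * s ^ (n + 1)), ?_, ?_⟩
      · exact Subalgebra.smul_mem _ (mul_mem (hsub _ hkk)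
          (pow_mem (Algebra.subset_adjoin (by simp)) _)) _
      · rw [D.map_smul, D.leibniz, hkk, D.leibniz_pow, hc, ← C_mul_X_pow_eq_monomial, map_mul,
          map_pow, Th2_X, Th2_C]
        have hn : ((n : K) + 1) ≠ 0 := by exact_mod_cast Nat.succ_ne_zero n
        simp only [smul_eq_mul, mul_zero, add_zero, nsmul_eq_mul, Nat.add_sub_cancel]
        have h2 : ((n + 1 : ℕ) : PolyR K) = ((n : K) + 1) • (1 : PolyR K) := by
          rw [MvPolynomial.smul_eq_C_mul]; simp
        rw [h2]
        simp only [smul_mul_assoc, mul_smul_comm, one_mul]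
        rw [smul_smul, inv_mul_cancel₀ hn, one_smul]
        ring
  intro n
  induction n with
  | zero =>
    intro a ha
    refine ⟨0, ?_⟩
    have : a = 0 := ha
    rw [this]; simp
  | succ n ih =>
    intro a ha
    rw [Function.iterate_succ_apply] at ha
    obtain ⟨m, hm⟩ := ih _ ha
    obtain ⟨g, hg, hg'⟩ := hanti _ hm
    refine ⟨m + 1, ?_⟩
    have h0 : D ((aeval u c) ^ (m + 1) * a - g) = 0 := by
      rw [map_sub, hg', D.leibniz, D.leibniz_pow, hcD]
      simp only [smul_eq_mul, mul_zero, add_zero, smul_zero]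
      ring
    have := add_mem (hsub _ h0) hg
    simpa using this

theorem pi_ker {K L : Type} [Field K] [Field L] (c1 : K[X]) (q : K[X] →+* L)
    (hq : ∀ r, q r = 0 ↔ c1 ∣ r) (G : K[X][X][X]) :
    mapRingHom (mapRingHom q) G = 0 ↔ C (C c1) ∣ G := by
  rw [C_dvd_iff_dvd_coeff]
  simp only [C_dvd_iff_dvd_coeff, ← hq]
  constructor
  · intro h i j
    have := congrArg (fun P => (P.coeff i).coeff j) h
    simpa using this
  · intro h
    ext i j
    simpa using h i j

theorem core {K L : Type} [Field K] [CharZero K] [Field L]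
    (D : Derivation K (PolyR K) (PolyR K)) (hirr : IrredDer K D)
    (u p s v w : PolyR K) (hcoord : Algebra.adjoin K {u, v, w} = ⊤)
    (hk : ∀ a, D a = 0 ↔ a ∈ Algebra.adjoin K {u, p}) (c c1 : K[X]) (hc : D s = aeval u c)
    (hc1 : c1 ∣ c)
    (hinj : Function.Injective (Th2 (aeval u : K[X] →ₐ[K] _).toRingHom p s))
    (q : K[X] →+* L) (hqs : Function.Surjective q) (hq : ∀ r, q r = 0 ↔ c1 ∣ r)
    (hc10 : c1 ≠ 0) :
    ∃ m : L[X][X], m.Monic ∧ Irreducible m ∧ ∀ G : K[X][X][X],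
      aeval u c1 ∣ Th2 (aeval u).toRingHom p s G ↔ m ∣ mapRingHom (mapRingHom q) G := by
  have hL : CharZero L := charZero_of_injective_ringHom (q.comp C).injective
  have hcD : ∀ r : K[X], D (aeval u r) = 0 := fun r =>
    (hk _).2 (Algebra.adjoin_mono (by simp) (aeval_mem_adjoin_singleton K u))
  have hc1u : aeval u c1 ≠ 0 := by
    intro h
    have h1 : Th2 (aeval u : K[X] →ₐ[K] _).toRingHom p s (C (C c1)) = 0 := by
      rw [Th2_CC]; exact h
    have h2 := hinj (h1.trans (map_zero _).symm)
    simp [hc10] at h2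
  set π := (mapRingHom (mapRingHom q) : K[X][X][X] →+* L[X][X]) with hπ
  have hπs : Function.Surjective π :=
    Polynomial.map_surjective _ (Polynomial.map_surjective _ hqs)
  -- the coordinate isomorphism
  have hinj1 : Function.Injective (Th2 (aeval u : K[X] →ₐ[K] _).toRingHom v w) := by
    apply Th2_inj3
    refine ⟨fun a => ?_⟩
    have ha : a ∈ Algebra.adjoin K {u, v, w} := by rw [hcoord]; trivial
    exact isAlgebraic_algebraMap (⟨a, ha⟩ : Algebra.adjoin K {u, v, w})
  have hsurj1 : Function.Surjective (Th2 (aeval u : K[X] →ₐ[K] _).toRingHom v w) := by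
    intro a
    exact (mem_adjoin3 u v w a).1 (by rw [hcoord]; trivial)
  let e := RingEquiv.ofBijective _ ⟨hinj1, hsurj1⟩
  have he : ∀ G, e G = Th2 (aeval u : K[X] →ₐ[K] _).toRingHom v w G := fun G => rfl
  let ρ : PolyR K →+* L[X][X] := π.comp e.symm.toRingHom
  have hρe : ∀ G, ρ (e G) = π G := fun G => by simp [ρ]
  have hρs : Function.Surjective ρ := hπs.comp e.symm.surjective
  have hρu : ∀ r : K[X], ρ (aeval u r) = C (C (q r)) := by
    intro r
    have : aeval u r = e (C (C r)) := by rw [he, Th2_CC]; rfl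
    rw [this, hρe]; simp [hπ]
  have hρk : ∀ a, ρ a = 0 ↔ aeval u c1 ∣ a := by
    intro a
    obtain ⟨G, rfl⟩ := e.surjective a
    have : aeval u c1 = e (C (C c1)) := by rw [he, Th2_CC]; rfl
    rw [hρe, pi_ker c1 q hq, this, map_dvd_iff e]
  clear_value ρ
  -- the induced map
  have hcomm : ∀ G, ρ (Th2 (aeval u : K[X] →ₐ[K] _).toRingHom p s G)
      = Th2 (C.comp C : L →+* L[X][X]) (ρ p) (ρ s) (π G) := by
    intro G
    have : ρ.comp (Th2 (aeval u : K[X] →ₐ[K] _).toRingHom p s)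
      = (Th2 (C.comp C : L →+* L[X][X]) (ρ p) (ρ s)).comp π := by
      apply Polynomial.ringHom_ext'
      · apply Polynomial.ringHom_ext'
        · apply RingHom.ext
          intro r
          have := hρu r
          simp only [RingHom.comp_apply, Th2_CC]
          rw [show (aeval u : K[X] →ₐ[K] _).toRingHom r = aeval u r from rfl, this]
          simp [hπ, Th2]
        · simp [hπ, Th2]
      · simp [hπ, Th2]
    exact congrArg (fun f => f G) this
  -- transcendence of the image of p
  have hptr : Function.Injective (eval₂RingHom (C.comp C : L →+* L[X][X]) (ρ p)) := by
    rw [injective_iff_map_eq_zero]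
    intro g hg
    obtain ⟨G, rfl⟩ := Polynomial.map_surjective q hqs g
    have h1 : Th2 (C.comp C : L →+* L[X][X]) (ρ p) (ρ s) (π (C G)) = 0 := by
      have : π (C G) = C (G.map q) := by simp [hπ]
      rw [this, Th2_C]; exact hg
    rw [← hcomm, hρk, Th2_C] at h1
    obtain ⟨a, ha⟩ := h1
    have hDa : D a = 0 := by
      have h2 : D (eval₂ (aeval u).toRingHom p G) = 0 := (hk _).2 ((mem_adjoin2 u p _).2 ⟨G, rfl⟩)
      rw [ha, D.leibniz, hcD, smul_zero, add_zero, smul_eq_mul, mul_eq_zero] at h2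
      exact h2.resolve_left hc1u
    obtain ⟨A, rfl⟩ := (mem_adjoin2 u p _).1 ((hk _).1 hDa)
    have h3 : Th2 (aeval u : K[X] →ₐ[K] _).toRingHom p s (C G)
        = Th2 (aeval u : K[X] →ₐ[K] _).toRingHom p s (C (C c1) * C A) := by
      rw [map_mul, Th2_CC, Th2_C, Th2_C, ha]; rfl
    have h4 := hinj h3
    rw [← C_mul] at h4
    rw [C_injective h4, Polynomial.map_mul, map_C, (hq c1).2 dvd_rfl]
    simp
  -- dependence
  have hdep : ¬ Function.Injective (Th2 (C.comp C : L →+* L[X][X]) (ρ p) (ρ s)) := by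
    intro hI
    choose sec hsec using hρs
    let D' : L[X][X] → L[X][X] := fun x => ρ (D (sec x))
    have hD' : ∀ a, D' (ρ a) = ρ (D a) := by
      intro a
      have h1 : ρ (sec (ρ a) - a) = 0 := by rw [map_sub, hsec, sub_self]
      obtain ⟨b, hb⟩ := (hρk _).1 h1
      have h2 : D (sec (ρ a)) = D a + aeval u c1 * D b := by
        have : sec (ρ a) = a + aeval u c1 * b := by rw [← hb]; ring
        rw [this, map_add, D.leibniz, hcD]; simp
      show ρ (D (sec (ρ a))) = _
      rw [h2, map_add, map_mul, (hρk (aeval u c1)).2 dvd_rfl]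
      simp
    clear_value D'
    have hρs : Function.Surjective ρ := fun x => ⟨_, hsec x⟩
    have hall : ∀ x, D' x = 0 := by
      intro x
      obtain ⟨G, hG0, hG⟩ := alg_of_inj2 (ρ p) (ρ s) hI x
      refine deriv_zero_aux _ hI D' ?_ ?_ ?_ x _ G rfl hG0 hG
      · intro x y
        obtain ⟨a, rfl⟩ := hρs x
        obtain ⟨b, rfl⟩ := hρs y
        rw [← map_add, hD', hD', hD', map_add, map_add]
      · intro x y
        obtain ⟨a, rfl⟩ := hρs x
        obtain ⟨b, rfl⟩ := hρs y
        rw [← map_mul, hD', hD', hD', D.leibniz]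
        simp
      · intro g
        obtain ⟨G, rfl⟩ := hπs g
        rw [← hcomm, hD', hρk]
        induction G using Polynomial.induction_on' with
        | add G H hG hH =>
          rw [map_add, map_add]; exact dvd_add hG hH
        | monomial n k =>
          have hkk : D (eval₂ (aeval u).toRingHom p k) = 0 :=
            (hk _).2 ((mem_adjoin2 u p _).2 ⟨k, rfl⟩)
          rw [← C_mul_X_pow_eq_monomial, map_mul, map_pow, Th2_X, Th2_C, D.leibniz, hkk,
            D.leibniz_pow, hc]
          obtain ⟨c2, rfl⟩ := hc1
          rw [map_mul]
          simp only [smul_eq_mul, mul_zero, add_zero, nsmul_eq_mul]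
          refine ⟨eval₂ (aeval u).toRingHom p k * (n * (s ^ (n - 1) * aeval u c2)), by ring⟩
    have hunit := hirr (aeval u c1) (fun i => by rw [← hρk, ← hD', hall])
    have := hunit.map ρ
    rw [(hρk (aeval u c1)).2 dvd_rfl] at this
    exact not_isUnit_zero this
  obtain ⟨m, hm, hmi, hmk⟩ := key_min _ hptr (ρ s) (integral_main _ _ hptr hdep)
  refine ⟨m, hm, hmi, fun G => ?_⟩
  rw [← hρk, hcomm, ← hmk]
  rfl

end Helpers

/-- For a prime factor `c₁` of `c`, the ideal `I_{c₁}^X = c₁·K[x,y,z] ∩ K[u,p,s]` is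
generated (over `K[u,p,s]`) by `c₁` and a polynomial `h₁` monic in `s`; the residue of
`h₁` in `K[u,p,s]/(c₁)` (i.e. in `(K[u]/(c₁))[p,s]`) is irreducible and unique up to a
nonzero scalar from the field `K[u]/(c₁)`. -/
theorem groebner_basis_of_Ic1 {K : Type} [Field K] [CharZero K]
    (X : Derivation K (PolyR K) (PolyR K))
    (hln : LND K X) (hirr : IrredDer K X) (hrk : rankD K X = 2)
    (u p : PolyR K) (hu : IsCoord K u)
    (hker : {a : PolyR K | X a = 0} = (Algebra.adjoin K {u, p} : Subalgebra K (PolyR K)))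
    (s : PolyR K) (hs : IsMinLocalSlice K X s)
    (c c1 : Polynomial K) (hc : X s = Polynomial.aeval u c)
    (hc1 : Prime c1) (hc1c : c1 ∣ c) :
    ∃ (d : ℕ) (a : Fin d → PolyR K) (h1 : PolyR K),
      (∀ i : Fin d, a i ∈ Algebra.adjoin K {u, p}) ∧
      h1 = s ^ d + ∑ i : Fin d, a i * s ^ (i : ℕ) ∧
      (∀ h : PolyR K,
        (Polynomial.aeval u c1 ∣ h ∧ h ∈ Algebra.adjoin K {u, p, s}) ↔
        (∃ α ∈ Algebra.adjoin K {u, p, s}, ∃ β ∈ Algebra.adjoin K {u, p, s},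
          h = α * Polynomial.aeval u c1 + β * h1)) ∧
      ∀ (h1T c1T : Algebra.adjoin K {u, p, s}),
        (h1T : PolyR K) = h1 → (c1T : PolyR K) = Polynomial.aeval u c1 →
        Irreducible (Ideal.Quotient.mk (Ideal.span {c1T}) h1T) ∧
        ∀ (d' : ℕ) (a' : Fin d' → PolyR K) (h1' : PolyR K)
          (h1T' : Algebra.adjoin K {u, p, s}),
          (∀ i : Fin d', a' i ∈ Algebra.adjoin K {u, p}) →
          h1' = s ^ d' + ∑ i : Fin d', a' i * s ^ (i : ℕ) →
          (h1T' : PolyR K) = h1' →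
          (∀ h : PolyR K,
            (Polynomial.aeval u c1 ∣ h ∧ h ∈ Algebra.adjoin K {u, p, s}) ↔
            (∃ α ∈ Algebra.adjoin K {u, p, s}, ∃ β ∈ Algebra.adjoin K {u, p, s},
              h = α * Polynomial.aeval u c1 + β * h1')) →
          ∃ μ : Polynomial K, ¬ c1 ∣ μ ∧
            ∀ μT : Algebra.adjoin K {u, p, s},
              (μT : PolyR K) = Polynomial.aeval u μ →
              Ideal.Quotient.mk (Ideal.span {c1T}) h1T' =
                Ideal.Quotient.mk (Ideal.span {c1T}) μT *
                  Ideal.Quotient.mk (Ideal.span {c1T}) h1T := by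
  classical
  have hk : ∀ a, X a = 0 ↔ a ∈ Algebra.adjoin K {u, p} := fun a => by
    have := congrArg (fun S => a ∈ S) hker
    simpa using this
  obtain ⟨v, w, hcoord⟩ := hu
  have hc0 : Polynomial.aeval u c ≠ 0 := by rw [← hc]; exact hs.1.1
  have hinj : Function.Injective
      (Th2 (Polynomial.aeval u : Polynomial K →ₐ[K] _).toRingHom p s) := by
    apply Th2_inj3
    refine ⟨fun a => ?_⟩
    obtain ⟨n, _, hn⟩ := hln a
    obtain ⟨m, hm⟩ := slice_aux X u p s hk c hc n a hn
    have hcm : (Polynomial.aeval u c) ^ m ∈ Algebra.adjoin K {u, p, s} :=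
      pow_mem (Algebra.adjoin_mono (by simp) (Polynomial.aeval_mem_adjoin_singleton K u)) _
    refine ⟨Polynomial.C ⟨_, hcm⟩ * Polynomial.X - Polynomial.C ⟨_, hm⟩, ?_, ?_⟩
    · intro h
      have h1 := congrArg (fun P => (P.coeff 1 : Algebra.adjoin K {u, p, s}).1) h
      simp [Polynomial.coeff_C] at h1
      exact hc0 h1.1
    · simp [Algebra.algebraMap_eq_smul_one, Subalgebra.smul_def]
  obtain ⟨L, _, q, hqs, hq⟩ : ∃ (L : Type) (_ : Field L) (q : Polynomial K →+* L),
      Function.Surjective q ∧ ∀ r, q r = 0 ↔ c1 ∣ r := by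
    have : Fact (Irreducible c1) := ⟨hc1.irreducible⟩
    exact ⟨AdjoinRoot c1, inferInstance, AdjoinRoot.mk c1, AdjoinRoot.mk_surjective,
      fun r => AdjoinRoot.mk_eq_zero⟩
  obtain ⟨m, hmm, hmi, hmk⟩ := core X hirr u p s v w hcoord hk c c1 hc hc1c hinj q hqs hq hc1.ne_zero
  set π := (Polynomial.mapRingHom (Polynomial.mapRingHom q)) with hπ
  have hπs : Function.Surjective π :=
    Polynomial.map_surjective _ (Polynomial.map_surjective _ hqs)
  set Θ := (Th2 (Polynomial.aeval u : Polynomial K →ₐ[K] PolyR K).toRingHom p s) with hΘ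
  have hΘm : ∀ x, x ∈ Algebra.adjoin K {u, p, s} ↔ ∃ G, Θ G = x := mem_adjoin3 u p s
  have hΘc : ∀ r : Polynomial K, Θ (Polynomial.C (Polynomial.C r)) = Polynomial.aeval u r :=
    fun r => Th2_CC _ _ _ r
  have hπk : ∀ G, π G = 0 ↔ Polynomial.C (Polynomial.C c1) ∣ G := pi_ker c1 q hq
  obtain ⟨H, hHm, hHd, hHmon⟩ := Polynomial.lifts_and_natDegree_eq_and_monic
    (f := Polynomial.mapRingHom q) (p := m) (by
      obtain ⟨G, hG⟩ := hπs m
      exact (Polynomial.mem_lifts _).2 ⟨G, hG⟩) hmm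
  have hH : π H = m := hHm
  have hideal : ∀ (H' : Polynomial (Polynomial (Polynomial K))), π H' = m →
      ∀ h : PolyR K,
        (Polynomial.aeval u c1 ∣ h ∧ h ∈ Algebra.adjoin K {u, p, s}) ↔
        (∃ α ∈ Algebra.adjoin K {u, p, s}, ∃ β ∈ Algebra.adjoin K {u, p, s},
          h = α * Polynomial.aeval u c1 + β * Θ H') := by
    intro H' hH' h
    constructor
    · rintro ⟨hd, hB⟩
      obtain ⟨F, rfl⟩ := (hΘm h).1 hB
      obtain ⟨g, hg⟩ := (hmk F).1 hd
      obtain ⟨G, rfl⟩ := hπs g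
      have h0 : π (F - G * H') = 0 := by
        have h1 : π F = π (F - G * H') + π (G * H') := by
          rw [← map_add]
          congr 1
          ring
        rw [map_mul, hH', hg, mul_comm (π G)] at h1
        exact left_eq_add.1 (h1.trans (add_comm _ _))
      obtain ⟨A, hA⟩ := (hπk _).1 h0
      refine ⟨Θ A, (hΘm _).2 ⟨A, rfl⟩, Θ G, (hΘm _).2 ⟨G, rfl⟩, ?_⟩
      rw [← hΘc, ← map_mul, ← map_mul, ← map_add]
      congr 1
      rw [mul_comm A, ← hA]; ring
    · rintro ⟨α, hα, β, hβ, rfl⟩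
      obtain ⟨A, rfl⟩ := (hΘm α).1 hα
      obtain ⟨B, rfl⟩ := (hΘm β).1 hβ
      refine ⟨?_, (hΘm _).2 ⟨A * Polynomial.C (Polynomial.C c1) + B * H', ?_⟩⟩
      · apply dvd_add (dvd_mul_left _ _)
        apply Dvd.dvd.mul_left
        rw [hmk, hH']
      · rw [map_add, map_mul, map_mul, hΘc]
  refine ⟨H.natDegree, fun i => Θ (Polynomial.C (H.coeff i)), Θ H, ?_, ?_, hideal H hH, ?_⟩
  · intro i
    show Θ (Polynomial.C (H.coeff i)) ∈ _
    rw [hΘ, Th2_C]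
    exact (mem_adjoin2 u p _).2 ⟨_, rfl⟩
  · conv_lhs => rw [hHmon.as_sum]
    rw [map_add, map_pow, map_sum, Finset.sum_range]
    simp only [map_mul, map_pow]
    rw [hΘ, Th2_X]
  intro h1T c1T hh1T hc1T
  -- the reduction map on `K[u,p,s]`
  let Θr : Polynomial (Polynomial (Polynomial K)) →+* Algebra.adjoin K {u, p, s} :=
    Θ.codRestrict (Algebra.adjoin K {u, p, s}) (fun x => (hΘm _).2 ⟨x, rfl⟩)
  have hΘr : ∀ G, (Θr G : PolyR K) = Θ G := fun G => rfl
  let e := RingEquiv.ofBijective Θr ⟨fun G G' h => hinj (congrArg Subtype.val h), fun x => by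
    obtain ⟨G, hG⟩ := (hΘm _).1 x.2
    exact ⟨G, Subtype.ext hG⟩⟩
  have he : ∀ G, (e G : PolyR K) = Θ G := fun G => rfl
  clear_value e
  let τ : Algebra.adjoin K {u, p, s} →+* Polynomial (Polynomial L) := π.comp e.symm.toRingHom
  have hτe : ∀ G, τ (e G) = π G := fun G => by simp [τ]
  have hτs : Function.Surjective τ := hπs.comp e.symm.surjective
  have hc1e : c1T = e (Polynomial.C (Polynomial.C c1)) := Subtype.ext (by rw [he, hΘc, hc1T])
  have hτk : ∀ x, τ x = 0 ↔ c1T ∣ x := by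
    intro x
    obtain ⟨G, rfl⟩ := e.surjective x
    rw [hτe, hπk, hc1e, map_dvd_iff e]
  clear_value τ
  have hkerτ : Ideal.span {c1T} = RingHom.ker τ := by
    ext x
    rw [Ideal.mem_span_singleton, RingHom.mem_ker, hτk]
  let E := (Ideal.quotEquivOfEq hkerτ).trans (RingHom.quotientKerEquivOfSurjective hτs)
  have hE : ∀ x, E (Ideal.Quotient.mk (Ideal.span {c1T}) x) = τ x := fun x => rfl
  clear_value E
  have hh1e : h1T = e H := Subtype.ext (by rw [he, hh1T])
  have hτh : τ h1T = m := by rw [hh1e, hτe, hH]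
  refine ⟨?_, ?_⟩
  · rw [← MulEquiv.irreducible_iff E, hE, hτh]
    exact hmi
  intro d' a' h1' h1T' _ _ hh1T' hgen
  obtain ⟨H', rfl⟩ := e.surjective h1T'
  rw [he] at hh1T'
  subst hh1T'
  have hd1 : m ∣ π H' := by
    rw [← hmk]
    exact ((hgen (Θ H')).2 ⟨0, zero_mem _, 1, one_mem _, by ring⟩).1
  have hd2 : π H' ∣ m := by
    have h0 : Polynomial.aeval u c1 ∣ Θ H := by rw [hmk, hH]
    obtain ⟨α, hα, β, hβ, hab⟩ := (hgen (Θ H)).1 ⟨h0, (hΘm _).2 ⟨H, rfl⟩⟩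
    obtain ⟨A, rfl⟩ := (hΘm α).1 hα
    obtain ⟨B, rfl⟩ := (hΘm β).1 hβ
    rw [← hΘc, ← map_mul, ← map_mul, ← map_add] at hab
    have h2 := congrArg π (hinj hab)
    rw [hH, map_add, map_mul, map_mul, (hπk _).2 dvd_rfl, mul_zero, zero_add] at h2
    exact ⟨π B, by rw [h2, mul_comm]⟩
  obtain ⟨U, hU⟩ := associated_of_dvd_dvd hd1 hd2
  obtain ⟨r, hr, hrU⟩ := Polynomial.isUnit_iff.1 U.isUnit
  obtain ⟨l, hl, rfl⟩ := Polynomial.isUnit_iff.1 hr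
  obtain ⟨μ, rfl⟩ := hqs l
  refine ⟨μ, ?_, ?_⟩
  · rw [← hq]; exact hl.ne_zero
  intro μT hμT
  have hμe : μT = e (Polynomial.C (Polynomial.C μ)) := Subtype.ext (by rw [he, hΘc, hμT])
  apply E.injective
  rw [map_mul, hE, hE, hE, hτh, hτe, hμe, hτe, ← hU, ← hrU]
  simp [hπ, mul_comm]

end
end

section
/- Let K be a field of characteristic zero and X a rank-two irreducible locally nilpotent K-derivation of K[x,y,z]. Write K[x,y,z]^X = K[u,p] where u is a coordinate of K[x,y,z], let s be a minimal local slice of X, and write X(s) = c(u) = c1^{n1}···cr^{nr}, where the ci are irreducible in K[u] and pairwise non-associate. For each i let h_i ∈ K[u,p,s] be monic in s with I_{c_i}^X = (c_i, h_i). Then X is triangulable if and only if for every i = 1,…,r the following hold: (i) h_i ≡ Q_i(u, s + ℓ_i(u,p)) + μ_i(u)·p modulo c_i, where Q_i and ℓ_i are polynomials in one variable with coefficients in K[u] and μ_i(u) is invertible modulo c_i; and (ii) for every ℓ (a polynomial in one variable with coefficients in K[u]) with ℓ ≡ ℓ_i mod c_i for all i, setting v = s + ℓ(u,p), the pair u,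 v is a system of coordinates of K[x,y,z]. -/
noncomputable section

variable (K : Type) [Field K] [CharZero K]

namespace TR
open Polynomial

section api
variable {K : Type} [Field K]

def ev2h (u t : PolyR K) : Polynomial (Polynomial K) →+* PolyR K :=
  Polynomial.eval₂RingHom (Polynomial.aeval u).toRingHom t

lemma ev2_eq (u t : PolyR K) (G : Polynomial (Polynomial K)) : ev2 K u t G = ev2h u t G := rfl

@[simp] lemma ev2h_C (u t : PolyR K) (a : Polynomial K) : ev2h u t (C a) = aeval u a := by
  simp [ev2h]

@[simp] lemma ev2h_X (u t : PolyR K) : ev2h u t X = t := by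
  simp [ev2h]

lemma ev2h_comp (u t : PolyR K) (G H : Polynomial (Polynomial K)) :
    ev2h u t (G.comp H) = ev2h u (ev2h u t H) G := by
  induction G using Polynomial.induction_on' with
  | add p q hp hq => simp [hp, hq]
  | monomial n a => simp [← C_mul_X_pow_eq_monomial]

lemma ev2h_sub_dvd (u a b : PolyR K) (G : Polynomial (Polynomial K)) :
    a - b ∣ ev2h u a G - ev2h u b G := by
  simp only [ev2h, coe_eval₂RingHom, eval₂_eq_eval_map]
  exact sub_dvd_eval_sub _ _ _

lemma ev2h_dvd (u t : PolyR K) {a : Polynomial K} {G : Polynomial (Polynomial K)}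
    (h : C a ∣ G) : aeval u a ∣ ev2h u t G := by
  have := map_dvd (ev2h u t) h
  simpa using this

lemma X_aeval (D : Derivation K (PolyR K) (PolyR K)) {u : PolyR K} (hu : D u = 0)
    (a : Polynomial K) : D (aeval u a) = 0 := by
  rw [Derivation.map_aeval, hu, smul_zero]

lemma X_ev2h (D : Derivation K (PolyR K) (PolyR K)) {u : PolyR K} (hu : D u = 0)
    (t : PolyR K) (G : Polynomial (Polynomial K)) :
    D (ev2h u t G) = ev2h u t (derivative G) * D t := by
  induction G using Polynomial.induction_on' with
  | add p q hp hq => simp [hp, hq, add_mul]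
  | monomial n a =>
    rw [← C_mul_X_pow_eq_monomial]
    simp [X_aeval D hu, Derivation.leibniz_pow, derivative_X_pow]
    ring

lemma aeval_mem (u : PolyR K) {S : Subalgebra K (PolyR K)} (hu : u ∈ S) (a : Polynomial K) :
    aeval u a ∈ S := by
  have h1 : Algebra.adjoin K {u} ≤ S := Algebra.adjoin_le (by simpa using hu)
  apply h1
  rw [Algebra.adjoin_singleton_eq_range_aeval]
  exact ⟨a, rfl⟩

lemma ev2h_mem {u t : PolyR K} {S : Subalgebra K (PolyR K)} (hu : u ∈ S) (ht : t ∈ S)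
    (G : Polynomial (Polynomial K)) : ev2h u t G ∈ S := by
  induction G using Polynomial.induction_on' with
  | add p q hp hq => rw [map_add]; exact S.add_mem hp hq
  | monomial n a =>
    rw [← C_mul_X_pow_eq_monomial]
    simp only [map_mul, map_pow, ev2h_C, ev2h_X]
    exact S.mul_mem (aeval_mem u hu a) (S.pow_mem ht n)

lemma mem_adjoin1 {u x : PolyR K} : x ∈ Algebra.adjoin K {u} ↔ ∃ a : Polynomial K, aeval u a = x := by
  rw [Algebra.adjoin_singleton_eq_range_aeval]; rfl

lemma mem_adjoin2 {u t x : PolyR K} : x ∈ Algebra.adjoin K {u, t} ↔ ∃ G, ev2h u t G = x := by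
  constructor
  · intro h
    induction h using Algebra.adjoin_induction with
    | mem x hx =>
      rcases hx with rfl | hx
      · exact ⟨C X, by simp⟩
      · rw [Set.mem_singleton_iff] at hx; subst hx; exact ⟨X, by simp⟩
    | algebraMap r => exact ⟨C (C r), by simp⟩
    | add x y _ _ hx hy => obtain ⟨a, rfl⟩ := hx; obtain ⟨b, rfl⟩ := hy; exact ⟨a + b, by simp⟩
    | mul x y _ _ hx hy => obtain ⟨a, rfl⟩ := hx; obtain ⟨b, rfl⟩ := hy; exact ⟨a * b, by simp⟩
  · rintro ⟨G, rfl⟩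
    exact ev2h_mem (Algebra.subset_adjoin (by simp)) (Algebra.subset_adjoin (by simp)) G

def ev3 (u v w : PolyR K) : Polynomial (Polynomial (Polynomial K)) →+* PolyR K :=
  Polynomial.eval₂RingHom (ev2h u v) w

@[simp] lemma ev3_C (u v w : PolyR K) (a) : ev3 u v w (C a) = ev2h u v a := by
  simp [ev3]

@[simp] lemma ev3_X (u v w : PolyR K) : ev3 u v w X = w := by
  simp [ev3]

lemma ev3_mem {u v w : PolyR K} {S : Subalgebra K (PolyR K)} (hu : u ∈ S) (hv : v ∈ S)
    (hw : w ∈ S) (G) : ev3 u v w G ∈ S := by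
  induction G using Polynomial.induction_on' with
  | add p q hp hq => rw [map_add]; exact S.add_mem hp hq
  | monomial n a =>
    rw [← C_mul_X_pow_eq_monomial]
    simp only [map_mul, map_pow, ev3_C, ev3_X]
    exact S.mul_mem (ev2h_mem hu hv a) (S.pow_mem hw n)

lemma noeth_inj {R : Type*} [CommRing R] [IsNoetherianRing R] (f : R →+* R)
    (hf : Function.Surjective f) : Function.Injective f := by
  rw [injective_iff_map_eq_zero]
  intro x hx
  let I : ℕ →o Ideal R :=
    { toFun := fun n => RingHom.ker (f ^ n)
      monotone' := monotone_nat_of_le_succ (fun n y hy => by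
        rw [RingHom.mem_ker] at hy ⊢
        rw [pow_succ', RingHom.mul_def, RingHom.comp_apply, hy, map_zero]) }
  obtain ⟨n, hn⟩ := (monotone_stabilizes_iff_noetherian (R := R) (M := R)).2 inferInstance I
  have hsn : Function.Surjective (f ^ n) := by
    rw [RingHom.coe_pow]; exact hf.iterate n
  obtain ⟨y, rfl⟩ := hsn x
  have h1 : y ∈ I (n + 1) := by
    change (f ^ (n + 1)) y = 0
    rw [pow_succ', RingHom.mul_def, RingHom.comp_apply, hx]
  rw [← hn (n + 1) (by omega)] at h1
  exact h1

lemma coord_lift {u v w : PolyR K} (h : Algebra.adjoin K {u, v, w} = ⊤) :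
    Function.Bijective (MvPolynomial.aeval (R := K) ![u, v, w]) := by
  have hs : Function.Surjective (MvPolynomial.aeval (R := K) ![u, v, w]) := by
    rw [← AlgHom.range_eq_top, ← Algebra.adjoin_range_eq_range_aeval, ← h]
    congr 1
    ext x
    simp only [Matrix.range_cons, Matrix.range_empty, Set.union_empty]
    simp
    tauto
  refine ⟨?_, hs⟩
  exact noeth_inj
    (MvPolynomial.aeval (R := K) ![u, v, w]).toRingHom hs

lemma ev3_bij {u v w : PolyR K} (h : Algebra.adjoin K {u, v, w} = ⊤) :
    Function.Bijective (ev3 u v w) := by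
  have hb := coord_lift h
  let std := ev3 (MvPolynomial.X 0 : PolyR K) (MvPolynomial.X 1) (MvPolynomial.X 2)
  let inv : PolyR K →ₐ[K] Polynomial (Polynomial (Polynomial K)) :=
    MvPolynomial.aeval (R := K) (S₁ := Polynomial (Polynomial (Polynomial K))) ![C (C X), C X, X]
  have h1 : ev3 u v w = (MvPolynomial.aeval (R := K) ![u, v, w]).toRingHom.comp std := by
    ext <;> simp [std]
  have h2 : inv.toRingHom.comp std = RingHom.id _ := by
    ext <;> simp [std, inv]
  have h3 : std.comp inv.toRingHom = RingHom.id _ := by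
    apply MvPolynomial.ringHom_ext
    · intro r; simp [std, inv]
    · intro i; fin_cases i <;> simp [std, inv]
  have hstd : Function.Bijective std := by
    refine Function.bijective_iff_has_inverse.mpr ⟨inv, fun x => ?_, fun x => ?_⟩
    · exact congrArg (fun f => f x) h2
    · exact congrArg (fun f => f x) h3
  rw [h1]
  exact hb.comp hstd

lemma ev2h_inj {u v w : PolyR K} (h : Algebra.adjoin K {u, v, w} = ⊤) :
    Function.Injective (ev2h u v) := by
  intro a b hab
  have : ev3 u v w (C a) = ev3 u v w (C b) := by simpa using hab
  exact C_injective ((ev3_bij h).1 this)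

lemma aeval_inj {u v w : PolyR K} (h : Algebra.adjoin K {u, v, w} = ⊤) :
    Function.Injective (aeval u : Polynomial K → PolyR K) := by
  intro a b hab
  have : ev2h u v (C a) = ev2h u v (C b) := by simpa using hab
  exact C_injective (ev2h_inj h this)

lemma dvd_ev2h {u v w : PolyR K} (h : Algebra.adjoin K {u, v, w} = ⊤) {a : Polynomial K}
    {G : Polynomial (Polynomial K)} (hd : aeval u a ∣ ev2h u v G) : C a ∣ G := by
  obtain ⟨q, hq⟩ := hd
  obtain ⟨q, rfl⟩ := (ev3_bij h).2 q
  have : C G = C (C a) * q := by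
    apply (ev3_bij h).1
    simp [hq]
  have h2 := (C_dvd_iff_dvd_coeff (C a) (C G)).1 ⟨q, this⟩ 0
  simpa using h2

end api


section alg
variable {B S : Type*} [CommRing B] [CommRing S]

lemma eval2_sub_dvd (f : B →+* S) (a b : S) (G : Polynomial B) :
    a - b ∣ eval₂ f a G - eval₂ f b G := by
  simp only [eval₂_eq_eval_map]
  exact sub_dvd_eval_sub _ _ _

lemma eval2_dvd (f : B →+* S) (t : S) {a : B} {G : Polynomial B}
    (h : C a ∣ G) : f a ∣ eval₂ f t G := by
  obtain ⟨q, rfl⟩ := h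
  rw [eval₂_mul, eval₂_C]
  exact Dvd.intro _ rfl

lemma comp_sub_dvd (a b G : Polynomial B) : a - b ∣ G.comp a - G.comp b :=
  eval2_sub_dvd C a b G

lemma inv_mod_aux (e : B) (M : Polynomial B) (k : ℕ) :
    ∃ Φ : Polynomial B, C (e ^ k) ∣ Φ + C e * M.comp Φ - X := by
  induction k with
  | zero => exact ⟨0, by simp⟩
  | succ k ih =>
    obtain ⟨Φ, hΦ⟩ := ih
    refine ⟨X - C e * M.comp Φ, ?_⟩
    have h1 := comp_sub_dvd (X - C e * M.comp Φ) Φ M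
    have h2 : C (e ^ k) ∣ X - C e * M.comp Φ - Φ := by
      rw [← dvd_neg]
      convert hΦ using 1
      ring
    have h3 := mul_dvd_mul_left (C e) (h2.trans h1)
    rw [pow_succ', C_mul]
    convert h3 using 1
    ring

lemma inv_mod (c e : B) (N : ℕ) (h : c ∣ e ^ N) (M : Polynomial B) :
    ∃ Φ : Polynomial B, C c ∣ Φ + C e * M.comp Φ - X ∧
      C c ∣ Φ.comp (X + C e * M) - X := by
  obtain ⟨Φ, hΦ⟩ := inv_mod_aux e M N
  have hcN : (C c : Polynomial B) ∣ C (e ^ N) := map_dvd C h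
  refine ⟨Φ, hcN.trans hΦ, ?_⟩
  set y := Φ.comp (X + C e * M) with hy
  obtain ⟨t, ht⟩ := comp_sub_dvd y X M
  have h1 : C c ∣ (y - X) * (1 + C e * t) := by
    have h2 : C c ∣ (Φ + C e * M.comp Φ - X).comp (X + C e * M) := by
      obtain ⟨q, hq⟩ := hcN.trans hΦ
      rw [hq]; simp
    convert h2 using 1
    simp only [sub_comp, add_comp, mul_comp, C_comp, X_comp, comp_assoc, ← hy]
    rw [comp_X] at ht
    linear_combination -C e * ht
  have h2 : IsCoprime (C c) (1 + C e * t) := by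
    have : IsCoprime (C e) (1 + C e * t) := ⟨-t, 1, by ring⟩
    have := this.pow_left (m := N)
    rw [← C_pow] at this
    exact this.of_isCoprime_of_dvd_left hcN
  exact h2.dvd_of_dvd_mul_right h1

lemma gen_alg {a c2 : B} (hcop : IsCoprime a c2) (F H F2 : Polynomial B)
    (hF2 : C c2 ∣ F.comp (C a * X + H.comp (-F2)) - F2)
    (ha : C a ∣ F.comp H + X) :
    ((C : Polynomial B →+* _).comp (C : B →+* _)) (a * c2) ∣ (C (C c2) * X - C F2) +
      eval₂ ((C : Polynomial B →+* _).comp (C : B →+* _))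
        (C (C a * X) + eval₂ ((C : Polynomial B →+* _).comp (C : B →+* _))
          (C (C c2) * X - C F2) H) F := by
  set fB : B →+* Polynomial (Polynomial (B)) := C.comp C with hfB
  set P : Polynomial (Polynomial (B)) := C (C c2) * X - C F2 with hPdef
  have fBdef : ∀ b, fB b = C (C b) := fun b => rfl
  have evC : ∀ G0 G : Polynomial (B), eval₂ fB (C G0) G = C (G.comp G0) := by
    intro G0 G
    rw [comp, hom_eval₂]
  set Vv : Polynomial (Polynomial (B)) := C (C a * X) + eval₂ fB P H with hVdef
  have key1 : fB a ∣ P + eval₂ fB Vv F := by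
    have h1 := eval2_sub_dvd fB Vv (eval₂ fB P H) F
    have h2 : fB a ∣ Vv - eval₂ fB P H := ⟨C X, by simp [hVdef, fBdef]⟩
    have h3 := eval2_dvd fB P ha
    rw [eval₂_add, eval₂_X, eval₂_comp] at h3
    have := dvd_add (h2.trans h1) h3
    convert this using 1
    ring
  have key2 : fB c2 ∣ P + eval₂ fB Vv F := by
    have h0 : fB c2 ∣ P - C (-F2) := ⟨X, by simp [hPdef, fBdef]⟩
    have h1 := h0.trans (eval2_sub_dvd fB P (C (-F2)) H)
    rw [evC] at h1
    have h2 : fB c2 ∣ Vv - C (C a * X + H.comp (-F2)) := by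
      convert h1 using 1
      simp [hVdef]
    have h3 := h2.trans (eval2_sub_dvd fB Vv (C (C a * X + H.comp (-F2))) F)
    rw [evC] at h3
    have h4 : fB c2 ∣ C (F.comp (C a * X + H.comp (-F2)) - F2) := by
      obtain ⟨q, hq⟩ := hF2
      rw [hq, C_mul]
      exact Dvd.intro _ rfl
    have := dvd_add (dvd_add h0 h3) h4
    convert this using 1
    simp only [C_sub, C_neg]
    ring
  have hcop' : IsCoprime (fB a) (fB c2) := IsCoprime.map hcop fB
  rw [map_mul]; exact hcop'.mul_dvd key1 key2

end alg

section gen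
variable {K : Type} [Field K]

lemma gen {u v w : PolyR K} (h : Algebra.adjoin K {u, v, w} = ⊤) {c a c2 : Polynomial K}
    (hc : c = a * c2) (hcop : IsCoprime a c2) (hc0 : c ≠ 0)
    (F H F2 : Polynomial (Polynomial K)) (p V W : PolyR K)
    (hp : p = aeval u c * w - ev2h u v F)
    (hv : v = aeval u a * V + ev2h u p H)
    (hp2 : p = aeval u c2 * W - ev2h u V F2)
    (hF2 : C c2 ∣ F.comp (C a * X + H.comp (-F2)) - F2)
    (ha : C a ∣ F.comp H + X) : Algebra.adjoin K {u, V, W} = ⊤ := by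
  let fB : Polynomial K →+* Polynomial (Polynomial (Polynomial K)) := C.comp C
  let P : Polynomial (Polynomial (Polynomial K)) := C (C c2) * X - C F2
  have fBdef : ∀ b, fB b = C (C b) := fun b => rfl
  let Vv : Polynomial (Polynomial (Polynomial K)) := C (C a * X) + eval₂ fB P H
  have key : fB c ∣ P + eval₂ fB Vv F := by
    rw [hc]; exact gen_alg hcop F H F2 hF2 ha
  obtain ⟨t, ht⟩ := key
  have hfB : (ev3 u V W).comp fB = (aeval u).toRingHom := by
    apply RingHom.ext; intro b; simp [fB]
  have e2 : ∀ T G, ev3 u V W (eval₂ fB T G) = ev2h u (ev3 u V W T) G := by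
    intro T G
    rw [hom_eval₂, hfB]; rfl
  have hP : ev3 u V W P = p := by
    have : ev3 u V W P = ev3 u V W (C (C c2) * X) - ev3 u V W (C F2) :=
      RingHom.map_sub (ev3 u V W) (C (C c2) * X) (C F2)
    rw [this, hp2, map_mul]; simp
  have hVv : ev3 u V W Vv = v := by
    rw [hv]; simp [Vv, e2, hP]
  have h5 := congrArg (ev3 u V W) ht
  rw [map_add, e2, hP, hVv, map_mul, fBdef] at h5
  simp only [ev3_C, ev2h_C] at h5
  have hcu : aeval u c ≠ 0 := by
    intro h0; apply hc0; apply aeval_inj h; simpa using h0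
  have hw : w = ev3 u V W t := by
    apply mul_left_cancel₀ hcu
    rw [← h5, hp]; ring
  rw [eq_top_iff, ← h]
  have hu' : u ∈ Algebra.adjoin K {u, V, W} := Algebra.subset_adjoin (by simp)
  have hV' : V ∈ Algebra.adjoin K {u, V, W} := Algebra.subset_adjoin (by simp)
  have hW' : W ∈ Algebra.adjoin K {u, V, W} := Algebra.subset_adjoin (by simp)
  apply Algebra.adjoin_le
  rintro x (rfl | rfl | rfl)
  · exact hu'
  · rw [← hVv]; exact ev3_mem hu' hV' hW' _
  · rw [hw]; exact ev3_mem hu' hV' hW' _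

end gen


section ker
variable {K : Type} [Field K]

lemma exists_antideriv [CharZero K] (f : Polynomial (Polynomial K)) :
    ∃ F : Polynomial (Polynomial K), derivative F = f ∧ F.coeff 0 = 0 := by
  induction f using Polynomial.induction_on' with
  | add p q hp hq =>
    obtain ⟨P, hP, hP0⟩ := hp
    obtain ⟨Q, hQ, hQ0⟩ := hq
    exact ⟨P + Q, by simp [hP, hQ], by simp [hP0, hQ0]⟩
  | monomial n a =>
    refine ⟨monomial (n + 1) (C ((n + 1 : K)⁻¹) * a), ?_, ?_⟩
    · rw [derivative_monomial]
      congr 1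
      have h : ((n + 1 : ℕ) : Polynomial K) = C (n + 1 : K) := by simp
      rw [h, mul_comm, ← mul_assoc, ← C_mul, mul_inv_cancel₀ (Nat.cast_add_one_ne_zero n)]
      simp
    · simp [coeff_monomial]

lemma D_eval (D : Derivation K (PolyR K) (PolyR K)) (v : PolyR K) (q : Polynomial (PolyR K))
    (hq : ∀ i, D (q.coeff i) = 0) : D (eval v q) = eval v (derivative q) * D v := by
  rw [derivative_eval, eval_eq_sum, sum, sum, map_sum, Finset.sum_mul]
  refine Finset.sum_congr rfl fun i _ => ?_
  simp [hq, Derivation.leibniz_pow]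
  ring

lemma eval_trans [CharZero K] (D : Derivation K (PolyR K) (PolyR K)) {v : PolyR K}
    (hv : D v ≠ 0) (n : ℕ) : ∀ q : Polynomial (PolyR K), q.natDegree ≤ n →
    (∀ i, D (q.coeff i) = 0) → eval v q = 0 → q = 0 := by
  induction n with
  | zero =>
    intro q hd hq h0
    rw [eq_C_of_natDegree_le_zero hd] at h0 ⊢
    simp at h0
    simp [h0]
  | succ n ih =>
    intro q hd hq h0
    have h1 := D_eval D v q hq
    rw [h0, map_zero] at h1
    have h2 : eval v (derivative q) = 0 := by
      rcases mul_eq_zero.1 h1.symm with h | h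
      · exact h
      · exact absurd h hv
    have h3 : derivative q = 0 := by
      apply ih _ _ _ h2
      · exact (natDegree_derivative_le q).trans (by omega)
      · intro i
        rw [coeff_derivative, Derivation.leibniz, hq]
        simp [Derivation.map_natCast]
    have h4 := derivative_eq_zero.1 h3
    rw [eq_C_of_natDegree_le_zero h4.le] at h0 ⊢
    simp at h0
    simp [h0]

lemma C_dvd_iff_map {π : Polynomial K} {G : Polynomial (Polynomial K)} :
    C π ∣ G ↔ G.map (Ideal.Quotient.mk (Ideal.span {π})) = 0 := by
  rw [C_dvd_iff_dvd_coeff, Polynomial.ext_iff]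
  simp [Ideal.Quotient.eq_zero_iff_dvd]

/-- Triangular data. -/
structure Tri (D : Derivation K (PolyR K) (PolyR K)) (u v w : PolyR K) (c : Polynomial K)
    (F : Polynomial (Polynomial K)) : Prop where
  adj : Algebra.adjoin K {u, v, w} = ⊤
  hu : D u = 0
  hv : D v = aeval u c
  hw : D w = ev2h u v (derivative F)
  hc : c ≠ 0
  hF : F.coeff 0 = 0

variable {D : Derivation K (PolyR K) (PolyR K)} {u v w : PolyR K} {c : Polynomial K}
    {F : Polynomial (Polynomial K)}

def Tri.p (_ : Tri D u v w c F) : PolyR K := aeval u c * w - ev2h u v F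

lemma Tri.Dp (T : Tri D u v w c F) : D T.p = 0 := by
  simp [Tri.p, X_aeval D T.hu, X_ev2h D T.hu, T.hv, T.hw]
  ring

lemma Tri.cu (T : Tri D u v w c F) : aeval u c ≠ 0 := by
  intro h0; apply T.hc; apply aeval_inj T.adj; simpa using h0

lemma Tri.ne0 (T : Tri D u v w c F) {a : Polynomial K} (ha : a ≠ 0) : aeval u a ≠ 0 := by
  intro h0; apply ha; apply aeval_inj T.adj; simpa using h0

lemma Tri.p_congr (T : Tri D u v w c F) {π : Polynomial K} (hπ : π ∣ c)
    (G : Polynomial (Polynomial K)) :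
    aeval u π ∣ ev2h u T.p G - ev2h u v (G.comp (-F)) := by
  rw [ev2h_comp]
  refine dvd_trans ?_ (ev2h_sub_dvd _ _ _ _)
  rw [map_neg]
  have : aeval u π ∣ aeval u c := map_dvd (aeval u) hπ
  refine this.trans ⟨w, ?_⟩
  simp [Tri.p]

lemma comp_zero {R : Type*} [CommRing R] [IsDomain R] {G F : Polynomial R}
    (hF : F.natDegree ≠ 0) (h : G.comp F = 0) : G = 0 := by
  rcases comp_eq_zero_iff.1 h with h | ⟨_, h⟩
  · exact h
  · exfalso; apply hF; rw [h]; simp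

/-- `F` is nonconstant modulo every irreducible factor of `c`. -/
lemma Tri.nonconst (T : Tri D u v w c F) (hirr : IrredDer K D) {π : Polynomial K}
    (hπ : Irreducible π) (hd : π ∣ c) :
    (F.map (Ideal.Quotient.mk (Ideal.span {π}))).natDegree ≠ 0 := by
  intro h0
  have h1 : C π ∣ derivative F := by
    rw [C_dvd_iff_map, ← derivative_map, derivative_of_natDegree_zero h0]
  have h2 : aeval u π ∣ D w := by rw [T.hw]; exact ev2h_dvd _ _ h1
  have h3 : aeval u π ∣ D v := by rw [T.hv]; exact map_dvd (aeval u) hd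
  have h4 : ∀ x, aeval u π ∣ D x := by
    intro x
    have hx : x ∈ Algebra.adjoin K {u, v, w} := by rw [T.adj]; trivial
    induction hx using Algebra.adjoin_induction with
    | mem x hx =>
      rcases hx with rfl | rfl | rfl
      · rw [T.hu]; exact dvd_zero _
      · exact h3
      · exact h2
    | algebraMap r => simp
    | add x y _ _ hx hy => rw [map_add]; exact dvd_add hx hy
    | mul x y _ _ hx hy =>
      rw [Derivation.leibniz, smul_eq_mul, smul_eq_mul]
      exact dvd_add (hy.mul_left _) (hx.mul_left _)
  obtain ⟨q, hq⟩ := (hirr _ (fun i => h4 _)).exists_right_inv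
  have h5 : C π ∣ (1 : Polynomial (Polynomial K)) :=
    dvd_ev2h T.adj (by rw [map_one]; exact ⟨q, hq.symm⟩)
  have h6 := (C_dvd_iff_dvd_coeff π 1).1 h5 0
  rw [coeff_one_zero] at h6
  exact hπ.not_isUnit (isUnit_of_dvd_one h6)

lemma Tri.prime_step (T : Tri D u v w c F) (hirr : IrredDer K D) {π : Polynomial K}
    (hπ : Irreducible π) (hd : π ∣ c) {G : Polynomial (Polynomial K)}
    (hG : aeval u π ∣ ev2h u T.p G) : C π ∣ G := by
  have h1 : aeval u π ∣ ev2h u v (G.comp (-F)) := by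
    have := dvd_sub hG (T.p_congr hd G)
    simpa using this
  have h2 := C_dvd_iff_map.1 (dvd_ev2h T.adj h1)
  have : (Ideal.span {π}).IsPrime := (Ideal.span_singleton_prime hπ.ne_zero).2 hπ.prime
  rw [Polynomial.map_comp] at h2
  rw [C_dvd_iff_map]
  refine comp_zero ?_ h2
  rw [Polynomial.map_neg, natDegree_neg]
  exact T.nonconst hirr hπ hd

lemma Tri.clear (T : Tri D u v w c F) (hirr : IrredDer K D) (c0 : Polynomial K) :
    c0 ≠ 0 → (∀ π, Irreducible π → π ∣ c0 → π ∣ c) → ∀ a : PolyR K,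
    (∃ G, aeval u c0 * a = ev2h u T.p G) → ∃ G, a = ev2h u T.p G := by
  induction c0 using UniqueFactorizationMonoid.induction_on_prime with
  | h₁ => intro h; exact absurd rfl h
  | h₂ x hx =>
    rintro _ _ a ⟨G, hG⟩
    obtain ⟨y, hy⟩ := hx.exists_right_inv
    refine ⟨C y * G, ?_⟩
    have : aeval u x * aeval u y = 1 := by rw [← map_mul, hy, map_one]
    rw [map_mul, ← hG, ev2h_C, ← mul_assoc, mul_comm (aeval u y), this, one_mul]
  | h₃ a π ha hπ ih =>
    rintro h0 hall b ⟨G, hG⟩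
    have hd : aeval u π ∣ ev2h u T.p G := by
      rw [← hG, map_mul, mul_assoc]; exact Dvd.intro _ rfl
    obtain ⟨G1, rfl⟩ := T.prime_step hirr hπ.irreducible
      (hall π hπ.irreducible (Dvd.intro _ rfl)) hd
    refine ih ha (fun π' h1 h2 => hall π' h1 (h2.mul_left _)) b ⟨G1, ?_⟩
    apply mul_left_cancel₀ (T.ne0 hπ.ne_zero)
    rw [map_mul, map_mul, ev2h_C] at hG
    rw [← hG]; ring

lemma Tri.denom (T : Tri D u v w c F) (a : PolyR K) :
    ∃ (N : ℕ) (q : Polynomial (Polynomial (Polynomial K))),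
      aeval u (c ^ N) * a = ev3 u T.p v q := by
  have hw0 : aeval u c * w = ev3 u T.p v (C X + F.map C) := by
    have : ∀ F : Polynomial (Polynomial K), ev3 u T.p v (F.map C) = ev2h u v F := by
      intro F
      induction F using Polynomial.induction_on' with
      | add p q hp hq => simp [hp, hq]
      | monomial n a => simp [← C_mul_X_pow_eq_monomial]
    rw [map_add, this, ev3_C, ev2h_X, Tri.p]; ring
  have ha : a ∈ Algebra.adjoin K {u, v, w} := by rw [T.adj]; trivial
  induction ha using Algebra.adjoin_induction with
  | mem x hx =>
    rcases hx with rfl | rfl | rfl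
    · exact ⟨0, C (C X), by simp⟩
    · exact ⟨0, X, by simp⟩
    · exact ⟨1, _, by rw [pow_one]; exact hw0⟩
  | algebraMap r => exact ⟨0, C (C (C r)), by simp⟩
  | add x y _ _ hx hy =>
    obtain ⟨n, p, hp⟩ := hx
    obtain ⟨m, q, hq⟩ := hy
    refine ⟨n + m, C (C (c ^ m)) * p + C (C (c ^ n)) * q, ?_⟩
    rw [map_add, map_mul, map_mul, ← hp, ← hq]
    simp only [ev3_C, ev2h_C, map_pow]
    ring
  | mul x y _ _ hx hy =>
    obtain ⟨n, p, hp⟩ := hx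
    obtain ⟨m, q, hq⟩ := hy
    refine ⟨n + m, p * q, ?_⟩
    rw [map_mul, ← hp, ← hq]
    simp only [map_pow]
    ring

lemma Tri.ker [CharZero K] (T : Tri D u v w c F) (hirr : IrredDer K D) {a : PolyR K}
    (ha : D a = 0) : ∃ G, a = ev2h u T.p G := by
  obtain ⟨N, q, hq⟩ := T.denom a
  refine T.clear hirr (c ^ N) (pow_ne_zero _ T.hc)
    (fun π h1 h2 => h1.prime.dvd_of_dvd_pow h2) a ?_
  set Q := q.map (ev2h u T.p) with hQ
  have hQe : ev3 u T.p v q = eval v Q := by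
    rw [hQ, eval_map]; rfl
  have hQ0 : ∀ i, D (Q.coeff i) = 0 := by
    intro i
    rw [hQ, coeff_map, X_ev2h D T.hu, T.Dp, mul_zero]
  have hDv : D v ≠ 0 := by rw [T.hv]; exact T.cu
  have h1 := D_eval D v Q hQ0
  rw [← hQe, ← hq, Derivation.leibniz, ha, X_aeval D T.hu, smul_zero, smul_zero, add_zero] at h1
  have h2 : eval v (derivative Q) = 0 := by
    rcases mul_eq_zero.1 h1.symm with h | h
    · exact h
    · exact absurd h hDv
  have h3 : derivative Q = 0 := by
    apply eval_trans D hDv _ _ le_rfl _ h2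
    intro i
    rw [coeff_derivative, Derivation.leibniz, hQ0]
    simp [Derivation.map_natCast]
  have h4 := derivative_eq_zero.1 h3
  rw [hq, hQe, eq_C_of_natDegree_le_zero h4.le]
  exact ⟨q.coeff 0, by simp [hQ]⟩

end ker


section red
variable {K : Type} [Field K]
variable {D : Derivation K (PolyR K) (PolyR K)} {u v w : PolyR K} {c : Polynomial K}
    {F : Polynomial (Polynomial K)}

lemma two_zero {R : Type*} [CommRing R] [IsDomain R] {A E F : Polynomial R}
    (hF : 2 ≤ F.natDegree) (h : A.comp F * X + E.comp F = 0) : A = 0 ∧ E = 0 := by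
  have hF0 : F.natDegree ≠ 0 := by omega
  by_cases hA : A = 0
  · refine ⟨hA, comp_zero hF0 ?_⟩
    simpa [hA] using h
  · exfalso
    have h1 : A.comp F ≠ 0 := fun h => hA (comp_zero hF0 h)
    have h2 : E.comp F = -(A.comp F * X) := by linear_combination h
    have h3 := congrArg natDegree h2
    rw [natDegree_neg, natDegree_mul_X h1, natDegree_comp, natDegree_comp] at h3
    have h4 : F.natDegree ∣ 1 := by
      have ha : F.natDegree ∣ A.natDegree * F.natDegree + 1 := by
        rw [← h3]; exact Dvd.intro_left _ rfl
      exact (Nat.dvd_add_right (Dvd.intro_left _ rfl)).1 ha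
    have := Nat.dvd_one.1 h4
    omega

lemma Tri.prime_step2 (T : Tri D u v w c F) {π : Polynomial K}
    (hπ : Irreducible π) (hd : π ∣ c)
    (hdeg : 2 ≤ (F.map (Ideal.Quotient.mk (Ideal.span {π}))).natDegree)
    {A E : Polynomial (Polynomial K)}
    (hG : aeval u π ∣ ev2h u T.p A * v + ev2h u T.p E) : C π ∣ A ∧ C π ∣ E := by
  have h1 : aeval u π ∣ ev2h u v (A.comp (-F) * X + E.comp (-F)) := by
    have := dvd_sub hG (dvd_add ((T.p_congr hd A).mul_right v) (T.p_congr hd E))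
    convert this using 1
    rw [map_add, map_mul, ev2h_X]
    ring
  have h2 := C_dvd_iff_map.1 (dvd_ev2h T.adj h1)
  have : (Ideal.span {π}).IsPrime := (Ideal.span_singleton_prime hπ.ne_zero).2 hπ.prime
  rw [Polynomial.map_add, Polynomial.map_mul, Polynomial.map_comp, Polynomial.map_comp,
    Polynomial.map_X] at h2
  rw [C_dvd_iff_map, C_dvd_iff_map]
  refine two_zero ?_ h2
  rw [Polynomial.map_neg, natDegree_neg]
  exact hdeg

/-- `F` has degree at least two modulo every irreducible factor of `c`. -/
def Deg2 (c : Polynomial K) (F : Polynomial (Polynomial K)) : Prop :=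
  ∀ π, Irreducible π → π ∣ c → 2 ≤ (F.map (Ideal.Quotient.mk (Ideal.span {π}))).natDegree

lemma Tri.clear2 (T : Tri D u v w c F) (hdeg : Deg2 c F) (c0 : Polynomial K) :
    c0 ≠ 0 → (∀ π, Irreducible π → π ∣ c0 → π ∣ c) → ∀ A E : Polynomial (Polynomial K),
    aeval u c0 ∣ ev2h u T.p A * v + ev2h u T.p E → C c0 ∣ A := by
  induction c0 using UniqueFactorizationMonoid.induction_on_prime with
  | h₁ => intro h; exact absurd rfl h
  | h₂ x hx =>
    intro _ _ A E _
    exact (hx.map C).dvd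
  | h₃ a π ha hπ ih =>
    rintro h0 hall A E h
    have hd : aeval u π ∣ ev2h u T.p A * v + ev2h u T.p E := by
      refine dvd_trans ?_ h
      rw [map_mul]; exact Dvd.intro _ rfl
    have hπc := hall π hπ.irreducible (Dvd.intro _ rfl)
    obtain ⟨⟨A1, rfl⟩, ⟨E1, rfl⟩⟩ := T.prime_step2 hπ.irreducible hπc
      (hdeg π hπ.irreducible hπc) hd
    rw [C_mul]
    apply mul_dvd_mul_left
    refine ih ha (fun π' h1 h2 => hall π' h1 (h2.mul_left _)) A1 E1 ?_
    apply (mul_dvd_mul_iff_left (T.ne0 hπ.ne_zero)).1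
    rw [← map_mul]
    convert h using 1
    rw [map_mul, map_mul, ev2h_C]; ring

lemma Tri.min [CharZero K] (T : Tri D u v w c F) (hirr : IrredDer K D) (hdeg : Deg2 c F)
    {s : PolyR K} (hs : D (D s) = 0) : aeval u c ∣ D s := by
  obtain ⟨A, hA⟩ := T.ker hirr hs
  have he : D (aeval u c * s - D s * v) = 0 := by
    simp [X_aeval D T.hu, hs, T.hv]
    ring
  obtain ⟨E, hE⟩ := T.ker hirr he
  have : C c ∣ A := by
    refine T.clear2 hdeg c T.hc (fun _ _ h => h) A E ⟨s, ?_⟩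
    rw [← hA, ← hE]; ring
  rw [hA]
  exact ev2h_dvd _ _ this

lemma Tri.reduce [CharZero K] (T : Tri D u v w c F) (hirr : IrredDer K D) {π : Polynomial K}
    (hπ : Irreducible π) (hd : π ∣ c)
    (hdeg : (F.map (Ideal.Quotient.mk (Ideal.span {π}))).natDegree ≤ 1) :
    ∃ (V W : PolyR K) (c2 : Polynomial K) (F2 : Polynomial (Polynomial K)),
      Tri D u V W c2 F2 ∧ c2.natDegree < c.natDegree := by
  obtain ⟨k, c2, hc2, hck⟩ := WfDvdMonoid.max_power_factor T.hc hπ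
  have hk : k ≠ 0 := by
    rintro rfl
    apply hc2; simpa [hck] using hd
  have hcop : IsCoprime (π ^ k) c2 := ((hπ.coprime_iff_not_dvd).2 hc2).pow_left
  have hc20 : c2 ≠ 0 := by rintro rfl; simp at hc2
  have hkc : π ^ k ∣ c := ⟨c2, hck⟩
  have hc2c : c2 ∣ c := ⟨π ^ k, by rw [hck, mul_comm]⟩
  -- decompose F
  have hG : C π ∣ F - C (F.coeff 1) * X := by
    rw [C_dvd_iff_dvd_coeff]
    intro n
    rcases n with _ | _ | n
    · simp [T.hF]
    · simp
    · have : (F.map (Ideal.Quotient.mk (Ideal.span {π}))).coeff (n + 2) = 0 :=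
        coeff_eq_zero_of_natDegree_lt (by omega)
      rw [coeff_map, Ideal.Quotient.eq_zero_iff_dvd] at this
      simpa [coeff_X] using this
  obtain ⟨G, hG⟩ := hG
  have hα : ¬ π ∣ F.coeff 1 := by
    intro h
    have h1 : C π ∣ F := by
      have h2 : C π ∣ C (F.coeff 1) * X := (_root_.map_dvd C h).mul_right _
      have h3 : F = C (F.coeff 1) * X + C π * G := by rw [← hG]; ring
      rw [h3]
      exact dvd_add h2 (Dvd.intro _ rfl)
    apply T.nonconst hirr hπ hd
    rw [C_dvd_iff_map.1 h1, natDegree_zero]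
  obtain ⟨γ, b, hb⟩ : IsCoprime (π ^ k) (F.coeff 1) := ((hπ.coprime_iff_not_dvd).2 hα).pow_left
  set α := F.coeff 1 with hαd
  have hbC : C γ * C (π ^ k) + C b * C α = (1 : Polynomial (Polynomial K)) := by
    rw [← C_mul, ← C_mul, ← C_add, hb, C_1]
  obtain ⟨Φ, hΦ1, hΦ2⟩ := inv_mod (π ^ k) π k dvd_rfl (C b * G)
  have hbF : C (π ^ k) ∣ C b * F - (X + C π * (C b * G)) :=
    ⟨- C γ * X, by linear_combination C b * hG + X * hbC⟩
  set H0 := Φ.comp (C (-b) * X) with hH0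
  have hH0a : C (π ^ k) ∣ H0.comp (-F) - X := by
    have h1 : H0.comp (-F) = Φ.comp (C b * F) := by
      rw [hH0, comp_assoc]
      congr 1
      simp
      ring
    rw [h1]
    have := dvd_add (hbF.trans (comp_sub_dvd _ _ Φ)) hΦ2
    simpa using this
  have hH0b : C (π ^ k) ∣ F.comp H0 + X := by
    have h1 : C (π ^ k) ∣ C b * (F.comp H0 + X) := by
      have h2 : C (π ^ k) ∣ (C b * F - (X + C π * (C b * G))).comp H0 := by
        obtain ⟨q, hq⟩ := hbF
        rw [hq, mul_comp, C_comp]; exact Dvd.intro _ rfl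
      have h3 : C (π ^ k) ∣ (Φ + C π * (C b * G).comp Φ - X).comp (C (-b) * X) := by
        obtain ⟨q, hq⟩ := hΦ1
        rw [hq, mul_comp, C_comp]; exact Dvd.intro _ rfl
      have := dvd_add h2 h3
      convert this using 1
      simp only [sub_comp, add_comp, mul_comp, C_comp, X_comp, comp_assoc, ← hH0]
      rw [C_neg]
      ring
    have h4 : IsCoprime (C (π ^ k)) (C b : Polynomial (Polynomial K)) :=
      ⟨C γ, C α, by rw [← hbC]; ring⟩
    exact h4.dvd_of_dvd_mul_left h1
  obtain ⟨x, y, hxy⟩ := hcop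
  set H := C (y * c2) * H0 with hH
  have hHH0 : C (π ^ k) ∣ H - H0 := by
    refine ⟨- C x * H0, ?_⟩
    have : C x * C (π ^ k) + C (y * c2) = (1 : Polynomial (Polynomial K)) := by
      rw [← C_mul, ← C_add, hxy, C_1]
    rw [hH]
    linear_combination H0 * this
  have hHc2 : C c2 ∣ H := by
    rw [hH, C_mul]
    exact ((dvd_refl (C c2)).mul_left _).mul_right _
  have hHa : C (π ^ k) ∣ H.comp (-F) - X := by
    have h1 : C (π ^ k) ∣ (H - H0).comp (-F) := by
      obtain ⟨q, hq⟩ := hHH0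
      rw [hq, mul_comp, C_comp]; exact Dvd.intro _ rfl
    have := dvd_add h1 hH0a
    simpa using this
  have hHb : C (π ^ k) ∣ F.comp H + X := by
    have := dvd_add (hHH0.trans (comp_sub_dvd H H0 F)) hH0b
    convert this using 1
    ring
  have hV : aeval u (π ^ k) ∣ v - ev2h u T.p H := by
    have h1 := T.p_congr hkc H
    have h2 := ev2h_dvd u v hHa
    rw [map_sub, ev2h_X] at h2
    have := dvd_neg.2 (dvd_add h1 h2)
    convert this using 1
    ring
  obtain ⟨V, hV⟩ := hV
  set F2 := F.comp (C (π ^ k) * X) with hF2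
  have hF2V : ev2h u V F2 = ev2h u (aeval u (π ^ k) * V) F := by
    rw [hF2, ev2h_comp, map_mul, ev2h_C, ev2h_X]
  have hW : aeval u c2 ∣ T.p + ev2h u V F2 := by
    have h1 : aeval u c2 ∣ v - aeval u (π ^ k) * V := by
      rw [← hV]
      simpa using ev2h_dvd u T.p hHc2
    have h2 := h1.trans (ev2h_sub_dvd u v _ F)
    have h3 : aeval u c2 ∣ aeval u c * w := (map_dvd (aeval u) hc2c).mul_right w
    rw [hF2V]
    have := dvd_sub h3 h2
    convert this using 1
    rw [Tri.p]; ring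
  obtain ⟨W, hW⟩ := hW
  have hDV : D V = aeval u c2 := by
    apply mul_left_cancel₀ (T.ne0 (pow_ne_zero k hπ.ne_zero))
    have := congrArg D hV
    rw [map_sub, X_ev2h D T.hu, T.Dp, T.hv, Derivation.leibniz, X_aeval D T.hu] at this
    simp only [mul_zero, smul_zero, add_zero, sub_zero, smul_eq_mul] at this
    rw [← this, ← map_mul, ← hck]
  refine ⟨V, W, c2, F2, ⟨?_, T.hu, hDV, ?_, hc20, ?_⟩, ?_⟩
  · refine gen T.adj hck ⟨x, y, hxy⟩ T.hc F H F2 T.p V W rfl ?_ ?_ ?_ hHb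
    · rw [← hV]; ring
    · rw [← hW]; ring
    · have h1 : C c2 ∣ H.comp (-F2) := by
        obtain ⟨q, hq⟩ := hHc2
        rw [hq, mul_comp, C_comp]; exact Dvd.intro _ rfl
      have h2 := comp_sub_dvd (C (π ^ k) * X + H.comp (-F2)) (C (π ^ k) * X) F
      rw [add_sub_cancel_left] at h2
      exact h1.trans h2
  · apply mul_left_cancel₀ (T.ne0 hc20)
    have := congrArg D hW
    rw [map_add, X_ev2h D T.hu, T.Dp, hDV, Derivation.leibniz, X_aeval D T.hu] at this
    simp only [smul_zero, add_zero, zero_add, smul_eq_mul] at this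
    linear_combination -this
  · rw [coeff_zero_eq_eval_zero, hF2, eval_comp]
    simp [← coeff_zero_eq_eval_zero, T.hF]
  · rw [hck, natDegree_mul (pow_ne_zero k hπ.ne_zero) hc20, natDegree_pow]
    have := hπ.natDegree_pos
    have : 0 < k * π.natDegree := Nat.mul_pos (Nat.pos_of_ne_zero hk) this
    omega

lemma Tri.exists_min [CharZero K] (hirr : IrredDer K D) (n : ℕ) :
    ∀ (v w : PolyR K) (c : Polynomial K) (F : Polynomial (Polynomial K)), c.natDegree ≤ n →
    Tri D u v w c F → ∃ v w c F, Tri D u v w c F ∧ Deg2 c F := by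
  induction n using Nat.strong_induction_on with
  | _ n ih =>
    intro v w c F hn T
    by_cases h : Deg2 c F
    · exact ⟨v, w, c, F, T, h⟩
    · unfold Deg2 at h
      push Not at h
      obtain ⟨π, hπ, hd, hdeg⟩ := h
      obtain ⟨V, W, c2, F2, T2, hlt⟩ := T.reduce hirr hπ hd (by omega)
      exact ih c2.natDegree (by omega) V W c2 F2 le_rfl T2

end red


section fin
variable {K : Type} [Field K] [CharZero K]

lemma no_two {D : Derivation K (PolyR K) (PolyR K)} (hrk : rankD K D = 2) {a b d : PolyR K}
    (h : Algebra.adjoin K {a, b, d} = ⊤) (ha : D a = 0) (hb : D b = 0) : False := by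
  have h2 : 2 ≤ corank K D := by
    unfold corank
    apply le_csSup
    · refine ⟨3, ?_⟩
      rintro r ⟨l, rfl, -, m, hm, -⟩
      rw [List.length_append] at hm
      omega
    · refine ⟨[a, b], rfl, by simp [ha, hb], [d], rfl, ?_⟩
      rw [← h]
      congr 1
      ext x
      simp
  unfold rankD at hrk
  omega

lemma slice_gen {D : Derivation K (PolyR K) (PolyR K)} (hln : LND K D) {u p s : PolyR K}
    {k : K} (hk : k ≠ 0) (hs : D s = MvPolynomial.C k) (hu : D u = 0) (hp : D p = 0)
    (hker : ∀ a, D a = 0 → a ∈ Algebra.adjoin K {u, p}) :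
    Algebra.adjoin K {u, p, s} = ⊤ := by
  set S := Algebra.adjoin K {u, p, s} with hS
  have hle : Algebra.adjoin K {u, p} ≤ S := Algebra.adjoin_mono (by
    intro x hx; simp only [Set.mem_insert_iff, Set.mem_singleton_iff] at hx ⊢; tauto)
  have muS : u ∈ S := Algebra.subset_adjoin (by simp)
  have mpS : p ∈ S := Algebra.subset_adjoin (by simp)
  have msS : s ∈ S := Algebra.subset_adjoin (by simp)
  have hex : ∀ x ∈ S, ∃ q, ev3 u p s q = x := by
    intro x hx
    induction hx using Algebra.adjoin_induction with
    | mem x hx =>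
      simp only [Set.mem_insert_iff, Set.mem_singleton_iff] at hx
      rcases hx with rfl | rfl | rfl
      · exact ⟨C (C X), by simp⟩
      · exact ⟨C X, by simp⟩
      · exact ⟨X, by simp⟩
    | algebraMap r => exact ⟨C (C (C r)), by simp⟩
    | add x y _ _ hx hy =>
      obtain ⟨a, rfl⟩ := hx
      obtain ⟨b, rfl⟩ := hy
      exact ⟨a + b, map_add _ _ _⟩
    | mul x y _ _ hx hy =>
      obtain ⟨a, rfl⟩ := hx
      obtain ⟨b, rfl⟩ := hy
      exact ⟨a * b, map_mul _ _ _⟩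
  have hanti : ∀ q, ∃ y ∈ S, D y = ev3 u p s q := by
    intro q
    induction q using Polynomial.induction_on' with
    | add a b ha hb =>
      obtain ⟨y, hy, h1⟩ := ha
      obtain ⟨z, hz, h2⟩ := hb
      exact ⟨y + z, S.add_mem hy hz, by rw [map_add, map_add, h1, h2]⟩
    | monomial n g =>
      refine ⟨(((n : K) + 1) * k)⁻¹ • (ev2h u p g * s ^ (n + 1)),
        S.smul_mem (S.mul_mem (ev2h_mem muS mpS g) (S.pow_mem msS _)) _, ?_⟩
      have hn : ((n : K) + 1) ≠ 0 := by exact_mod_cast Nat.succ_ne_zero n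
      rw [← C_mul_X_pow_eq_monomial]
      simp only [map_mul, map_pow, ev3_C, ev3_X, Derivation.leibniz,
        Derivation.leibniz_pow, X_ev2h D hu, hp, hs, smul_eq_mul, mul_zero, add_zero,
        nsmul_eq_mul, MvPolynomial.smul_eq_C_mul, Nat.add_sub_cancel]
      have h1 : (MvPolynomial.C ((((n : K) + 1) * k)⁻¹) : PolyR K) * ((n + 1 : ℕ) : PolyR K)
          * MvPolynomial.C k = 1 := by
        rw [← map_natCast (MvPolynomial.C : K →+* PolyR K), ← map_mul, ← map_mul, ← map_one MvPolynomial.C]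
        congr 1
        push_cast
        field_simp
      have h0 : D (MvPolynomial.C ((((n : K) + 1) * k)⁻¹)) = 0 := D.map_algebraMap _
      linear_combination (ev2h u p g * s ^ n) * h1 + ev2h u p g * s * s ^ n * h0
  have hmain : ∀ n : ℕ, ∀ a, (⇑D)^[n] a = 0 → a ∈ S := by
    intro n
    induction n with
    | zero => intro a ha; simp only [Function.iterate_zero, id] at ha; rw [ha]; exact S.zero_mem
    | succ n ih =>
      intro a ha
      rw [Function.iterate_succ_apply] at ha
      obtain ⟨q, hq⟩ := hex _ (ih _ ha)
      obtain ⟨y, hy, h1⟩ := hanti q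
      have := hle (hker (a - y) (by rw [map_sub, h1, hq, sub_self]))
      simpa using S.add_mem this hy
  rw [eq_top_iff]
  intro a _
  obtain ⟨n, -, hn⟩ := hln a
  exact hmain n a hn

lemma alg_mem {u g h y : PolyR K} (hadj : Algebra.adjoin K {u, g, h} = ⊤) {P Q : Polynomial K}
    (hP : P.natDegree ≠ 0) (he : aeval y P = aeval u Q) : ∃ q : Polynomial K, y = aeval u q := by
  obtain ⟨Y, rfl⟩ := (ev3_bij hadj).2 y
  have key : ∀ (B : Type) [CommRing B] [IsDomain B] (j : K →+* B) (Y : Polynomial B) (b : B),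
      (P.map (C.comp j)).eval Y = C b → ∃ y, Y = C y := by
    intro B _ _ j Y b hb
    have h1 : (P.map (C.comp j)).eval Y = (P.map j).comp Y := by
      rw [Polynomial.comp, eval_map, eval₂_map]
    rw [h1] at hb
    have h2 := congrArg natDegree hb
    rw [natDegree_comp, natDegree_C, natDegree_map_eq_of_injective j.injective] at h2
    rcases Nat.mul_eq_zero.1 h2 with h2 | h2
    · exact absurd h2 hP
    · exact ⟨_, eq_C_of_natDegree_eq_zero h2⟩
  have hal : ∀ t, aeval (ev3 u g h t) P =
      ev3 u g h ((P.map (C.comp (C.comp C))).eval t) := by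
    intro t
    rw [eval_map, hom_eval₂, aeval_def]
    congr 1
    ext r
    simp
  rw [hal] at he
  have e1 : (P.map (C.comp (C.comp C))).eval Y = C (C Q) := by
    apply (ev3_bij hadj).1
    rw [he]; simp
  obtain ⟨y, rfl⟩ := key _ _ _ _ e1
  have e2 : (P.map (C.comp C)).eval y = C Q := by
    apply C_injective
    rw [← e1, eval_map, eval_map, hom_eval₂]
  obtain ⟨z, rfl⟩ := key _ _ _ _ e2
  exact ⟨z, by simp⟩

lemma D_ev3 (D : Derivation K (PolyR K) (PolyR K)) {u v w : PolyR K} {c : Polynomial K}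
    (hu : D u = 0) (hv : D v = aeval u c) {W : Polynomial (Polynomial (Polynomial K))}
    (hw : D w = ev3 u v w W) (q : Polynomial (Polynomial (Polynomial K))) :
    ∃ r : Polynomial (Polynomial (Polynomial K)), (∀ n, r.coeff n = derivative (q.coeff n)) ∧
      D (ev3 u v w q) = ev3 u v w (C (C c) * r + derivative q * W) := by
  induction q using Polynomial.induction_on' with
  | add a b ha hb =>
    obtain ⟨r1, h1, h1'⟩ := ha
    obtain ⟨r2, h2, h2'⟩ := hb
    refine ⟨r1 + r2, fun n => by simp [h1, h2], ?_⟩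
    rw [map_add, map_add, h1', h2', ← map_add, derivative_add]
    congr 1
    ring
  | monomial n a =>
    refine ⟨monomial n (derivative a), fun m => ?_, ?_⟩
    · rw [coeff_monomial, coeff_monomial]; split_ifs <;> simp
    · rw [derivative_monomial]
      simp only [← C_mul_X_pow_eq_monomial, map_add, map_mul, map_pow, ev3_C, ev3_X,
        Derivation.leibniz, Derivation.leibniz_pow, X_ev2h D hu, hv, hw, smul_eq_mul,
        ev2h_C, nsmul_eq_mul, map_natCast]
      ring

lemma tri_of {D : Derivation K (PolyR K) (PolyR K)} (hln : LND K D) {u v w : PolyR K}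
    {c : Polynomial K} (hadj : Algebra.adjoin K {u, v, w} = ⊤)
    (hu : D u = 0) (hv : D v = aeval u c) : ∃ f, D w = ev2h u v f := by
  obtain ⟨W, hW⟩ := (ev3_bij hadj).2 (D w)
  by_cases hd : W.natDegree = 0
  · rw [eq_C_of_natDegree_eq_zero hd, ev3_C] at hW
    exact ⟨_, hW.symm⟩
  exfalso
  obtain ⟨d, hd⟩ := Nat.exists_eq_succ_of_ne_zero hd
  have step : ∀ q : Polynomial (Polynomial (Polynomial K)), q.natDegree ≠ 0 →
      ∃ q', q'.natDegree ≠ 0 ∧ D (ev3 u v w q) = ev3 u v w q' := by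
    intro q hq
    obtain ⟨n, hn⟩ := Nat.exists_eq_succ_of_ne_zero hq
    obtain ⟨r, hr, hr'⟩ := D_ev3 D hu hv hW.symm q
    refine ⟨_, ?_, hr'⟩
    have ha0 : q.coeff (n + 1) ≠ 0 := by
      rw [← Nat.succ_eq_add_one, ← hn]
      exact leadingCoeff_ne_zero.2 (by rintro rfl; simp at hn)
    have hb0 : W.coeff (d + 1) ≠ 0 := by
      rw [← Nat.succ_eq_add_one, ← hd]
      exact leadingCoeff_ne_zero.2 (by rintro rfl; simp at hd)
    have hco : (C (C c) * r + derivative q * W).coeff (n + (d + 1)) ≠ 0 := by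
      rw [coeff_add, coeff_C_mul, hr, coeff_mul_add_eq_of_natDegree_le
        ((natDegree_derivative_le q).trans (by omega)) hd.le, coeff_derivative]
      set b := W.coeff (d + 1) with hb
      set a := q.coeff (n + 1) with ha
      have hn0 : ((n : Polynomial (Polynomial K)) + 1) ≠ 0 := by exact_mod_cast Nat.succ_ne_zero n
      have hdeg : a.degree ≤ (a * (n + 1) * b).degree := by
        rw [mul_assoc]
        exact degree_le_mul_left a (mul_ne_zero hn0 hb0)
      have hx : (C c * derivative (q.coeff (n + (d + 1)))).degree < a.degree := by
        have hbot : (⊥ : WithBot ℕ) < a.degree := bot_lt_iff_ne_bot.2 (by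
          rw [Ne, degree_eq_bot]; exact ha0)
        rcases Nat.eq_zero_or_pos d with rfl | hd0
        · have := degree_derivative_lt ha0
          rw [show n + (0 + 1) = n + 1 by omega, ← ha]
          refine lt_of_le_of_lt (by rw [← smul_eq_C_mul]; exact degree_smul_le _ _) this
        · rw [coeff_eq_zero_of_natDegree_lt (p := q) (by omega)]
          simpa using hbot
      intro h0
      have := degree_add_eq_right_of_degree_lt (hx.trans_le hdeg)
      rw [h0, degree_zero] at this
      have hh := hx.trans_le hdeg
      rw [← this] at hh
      exact not_lt_bot hh
    intro h0
    apply hco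
    apply coeff_eq_zero_of_natDegree_lt
    omega
  have it : ∀ n : ℕ, ∃ q : Polynomial (Polynomial (Polynomial K)), q.natDegree ≠ 0 ∧
      (⇑D)^[n] w = ev3 u v w q := by
    intro n
    induction n with
    | zero => exact ⟨X, by simp, by simp⟩
    | succ n ih =>
      obtain ⟨q, h1, h2⟩ := ih
      rw [Function.iterate_succ_apply', h2]
      exact step q h1
  obtain ⟨n, -, hn⟩ := hln w
  obtain ⟨q, h1, h2⟩ := it n
  rw [hn] at h2
  have : q = 0 := (ev3_bij hadj).1 (by rw [← h2, map_zero])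
  rw [this] at h1
  simp at h1

end fin


section final
variable {K : Type} [Field K] [CharZero K]

lemma nounit {D : Derivation K (PolyR K) (PolyR K)} (hln : LND K D) (hrk : rankD K D = 2)
    {u p s : PolyR K} (hu : D u = 0) (hp : D p = 0)
    (hker : ∀ a, D a = 0 → a ∈ Algebra.adjoin K {u, p})
    (hs : IsMinLocalSlice K D s) {t : PolyR K} {k : K} (hk : k ≠ 0)
    (ht : D t = MvPolynomial.C k) : False := by
  have hkC : (MvPolynomial.C k : PolyR K) ≠ 0 := by
    rw [Ne, MvPolynomial.C_eq_zero]; exact hk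
  have hunit : IsUnit (D t) := by
    rw [ht]; exact (IsUnit.mk0 k hk).map _
  have hD0 : D (D t) = 0 := by rw [ht]; exact D.map_algebraMap k
  obtain ⟨μ, hμ⟩ := hs.2 t ⟨by rw [ht]; exact hkC, hD0⟩ hunit.dvd
  have h2 : IsUnit (D s) := by
    rw [hμ] at hunit
    exact isUnit_of_mul_isUnit_right hunit
  obtain ⟨k', hk', h3⟩ := MvPolynomial.isUnit_iff_eq_C_of_isReduced.1 h2
  exact no_two hrk (slice_gen hln hk'.ne_zero h3 hu hp hker) hu hp

lemma pcop {r : ℕ} {ci : Fin r → Polynomial K} (hci : ∀ i, Irreducible (ci i))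
    (hpair : ∀ i j, i ≠ j → ¬ Associated (ci i) (ci j)) {i j : Fin r} (hij : i ≠ j) :
    IsCoprime (ci i) (ci j) := by
  rcases (hci i).isCoprime_or_dvd (ci j) with h | h
  · exact h
  · exact absurd ((hci i).associated_of_dvd (hci j) h) (hpair i j hij)

lemma crt {r : ℕ} {ci : Fin r → Polynomial K} (hci : ∀ i, Irreducible (ci i))
    (hpair : ∀ i j, i ≠ j → ¬ Associated (ci i) (ci j))
    (Ls : Fin r → Polynomial (Polynomial K)) :
    ∃ l : Polynomial (Polynomial K), ∀ i, C (ci i) ∣ l - Ls i := by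
  have h := Ideal.exists_forall_sub_mem_ideal
    (I := fun i => Ideal.span {(C (ci i) : Polynomial (Polynomial K))})
    (fun i j hij => by
      show IsCoprime _ _
      rw [Ideal.isCoprime_span_singleton_iff]
      exact (pcop hci hpair hij).map C) Ls
  obtain ⟨l, hl⟩ := h
  exact ⟨l, fun i => Ideal.mem_span_singleton.1 (hl i)⟩

lemma partii {D : Derivation K (PolyR K) (PolyR K)} (hirr : IrredDer K D) {u v w : PolyR K}
    {r : ℕ} {ci : Fin r → Polynomial K} {ni : Fin r → ℕ} (hci : ∀ i, Irreducible (ci i))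
    (hpair : ∀ i j, i ≠ j → ¬ Associated (ci i) (ci j))
    {F : Polynomial (Polynomial K)} (T : Tri D u v w (∏ i, ci i ^ ni i) F) {V : PolyR K}
    (hV : D (V - v) = 0) (hd : ∀ i, aeval u (ci i) ∣ V - v) :
    IsSysOfCoords2 K u V := by
  set c := ∏ i, ci i ^ ni i with hc
  set e := ∏ i, ci i with he
  have hed : aeval u e ∣ V - v := by
    rw [he, map_prod]
    apply Finset.prod_dvd_of_coprime
    · intro i _ j _ hij
      exact (pcop hci hpair hij).map (aeval u : Polynomial K →ₐ[K] PolyR K).toRingHom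
    · intro i _; exact hd i
  have he0 : e ≠ 0 := Finset.prod_ne_zero_iff.2 fun i _ => (hci i).ne_zero
  have hce : c ∣ e ^ (∑ i, ni i) := by
    rw [hc, he, ← Finset.prod_pow]
    apply Finset.prod_dvd_prod_of_dvd
    intro i _
    exact pow_dvd_pow _ (Finset.single_le_sum (f := ni) (fun _ _ => Nat.zero_le _) (Finset.mem_univ i))
  obtain ⟨m, hm⟩ := hed
  have hDm : D m = 0 := by
    rw [hm, Derivation.leibniz, X_aeval D T.hu, smul_zero, add_zero, smul_eq_mul] at hV
    exact (mul_eq_zero.1 hV).resolve_left (T.ne0 he0)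
  obtain ⟨M, rfl⟩ := T.ker hirr hDm
  obtain ⟨Φ, h1, h2⟩ := inv_mod c e _ hce (M.comp (-F))
  -- V ≡ E(v)
  have hVE : aeval u c ∣ V - ev2h u v (X + C e * M.comp (-F)) := by
    have := (T.p_congr dvd_rfl M).mul_left (aeval u e)
    convert this using 1
    rw [map_add, map_mul, ev2h_X, ev2h_C]
    linear_combination hm
  have hΦV : aeval u c ∣ ev2h u V Φ - v := by
    have a1 := hVE.trans (ev2h_sub_dvd u _ _ Φ)
    have a2 := ev2h_dvd u v h2
    rw [map_sub, ev2h_comp, ev2h_X] at a2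
    have := dvd_add a1 a2
    convert this using 1
    ring
  have hW : aeval u c ∣ T.p + ev2h u V (F.comp Φ) := by
    rw [ev2h_comp]
    have a1 := hΦV.trans (ev2h_sub_dvd u _ _ F)
    have a2 : aeval u c ∣ T.p + ev2h u v F := by
      unfold Tri.p
      rw [sub_add_cancel]; exact Dvd.intro _ rfl
    have := dvd_add a1 a2
    convert this using 1
    ring
  obtain ⟨W, hW⟩ := hW
  refine ⟨W, gen T.adj (c := c) (a := 1) (c2 := c) (one_mul c).symm isCoprime_one_left T.hc F
    (-(C e * M)) (F.comp Φ) T.p V W rfl ?_ ?_ ?_ ?_⟩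
  · rw [map_neg, map_mul, ev2h_C, map_one]
    linear_combination -hm
  · linear_combination hW
  · refine dvd_trans ?_ (comp_sub_dvd _ _ F)
    have := dvd_neg.2 h1
    convert this using 1
    simp [comp_assoc]
    ring
  · rw [map_one]; exact one_dvd _

end final


section final2
variable {K : Type} [Field K] [CharZero K]

/-- Triangular form adapted to the given `u` and `s`. -/
lemma forward {D : Derivation K (PolyR K) (PolyR K)} (hln : LND K D) (hirr : IrredDer K D)
    (hrk : rankD K D = 2) {u p s : PolyR K} (hcu : IsCoord K u) (hu : D u = 0) (hp : D p = 0)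
    (hker : ∀ a, D a = 0 → a ∈ Algebra.adjoin K {u, p})
    (hs : IsMinLocalSlice K D s) {c : Polynomial K} (hc : D s = aeval u c)
    (htri : Triangulable K D) :
    ∃ (v w : PolyR K) (F : Polynomial (Polynomial K)), Tri D u v w c F := by
  obtain ⟨u', v', w', hadj, h1, h2, h3⟩ := htri
  obtain ⟨k, hk⟩ := Algebra.mem_bot.1 h1
  have hu' : D u' = 0 := by
    by_contra hne
    have hk0 : k ≠ 0 := by
      rintro rfl
      rw [map_zero] at hk
      exact hne hk.symm
    exact nounit hln hrk hu hp hker hs hk0 hk.symm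
  obtain ⟨c', hc'⟩ := mem_adjoin1.1 h2
  obtain ⟨f', hf'⟩ := mem_adjoin2.1 h3
  obtain ⟨F', hF', hF0'⟩ := exists_antideriv f'
  have hc0' : c' ≠ 0 := by
    rintro rfl
    rw [map_zero] at hc'
    exact no_two hrk hadj hu' hc'.symm
  have T0 : Tri D u' v' w' c' F' := ⟨hadj, hu', hc'.symm, by rw [hF', hf'], hc0', hF0'⟩
  obtain ⟨v, w, c1, F1, T, hdeg⟩ := Tri.exists_min hirr c'.natDegree v' w' c' F' le_rfl T0
  have hvs : IsLocalSlice K D v := ⟨by rw [T.hv]; exact T.cu, by rw [T.hv]; exact X_aeval D T.hu _⟩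
  have hdvd : D v ∣ D s := by rw [T.hv]; exact T.min hirr hdeg hs.1.2
  obtain ⟨μ, hμ⟩ := hs.2 v hvs hdvd
  obtain ⟨k, hk, hkμ⟩ := MvPolynomial.isUnit_iff_eq_C_of_isReduced.1 μ.isUnit
  have hk0 : k ≠ 0 := hk.ne_zero
  rw [hkμ] at hμ
  have hd0 : c1.natDegree ≠ 0 := by
    intro h0
    rw [eq_C_of_natDegree_eq_zero h0] at T
    have hne : c1.coeff 0 ≠ 0 := by
      intro h; apply T.hc; rw [h, map_zero]
    refine nounit hln hrk hu hp hker hs hne (t := v) ?_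
    rw [T.hv, aeval_C]; rfl
  obtain ⟨g, h, hgh⟩ := hcu
  have hau : aeval u' c1 = aeval u (C k * c) := by
    rw [← T.hv, hμ, hc, map_mul, aeval_C]; rfl
  obtain ⟨q, hq⟩ := alg_mem hgh hd0 hau
  have hC1 : (MvPolynomial.C k⁻¹ : PolyR K) * MvPolynomial.C k = 1 := by
    rw [← map_mul, inv_mul_cancel₀ hk0, map_one]
  have hDC : D (MvPolynomial.C k⁻¹) = 0 := D.map_algebraMap _
  set v1 : PolyR K := MvPolynomial.C k⁻¹ * v with hv1
  have hvv1 : v = MvPolynomial.C k * v1 := by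
    rw [hv1]; linear_combination -v * hC1
  have hDv1 : D v1 = aeval u c := by
    rw [hv1, Derivation.leibniz, hDC, hμ, hc, smul_eq_mul, smul_zero, add_zero]
    linear_combination (aeval u c) * hC1
  have mu : ∀ S : Subalgebra K (PolyR K), u ∈ S → u' ∈ S := fun S hS => by
    rw [hq]; exact aeval_mem u hS q
  have mv : ∀ S : Subalgebra K (PolyR K), v1 ∈ S → v ∈ S := fun S hS => by
    rw [hvv1]; exact S.mul_mem (S.algebraMap_mem k) hS
  have hadj1 : Algebra.adjoin K {u, v1, w} = ⊤ := by
    rw [eq_top_iff, ← T.adj]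
    apply Algebra.adjoin_le
    intro x hx
    simp only [Set.mem_insert_iff, Set.mem_singleton_iff] at hx
    rcases hx with rfl | rfl | rfl
    · exact mu _ (Algebra.subset_adjoin (by simp))
    · exact mv _ (Algebra.subset_adjoin (by simp))
    · exact Algebra.subset_adjoin (by simp)
  have hDw : D w ∈ Algebra.adjoin K {u, v1} := by
    rw [T.hw]
    exact ev2h_mem (mu _ (Algebra.subset_adjoin (by simp)))
      (mv _ (Algebra.subset_adjoin (by simp))) _
  obtain ⟨f, hf⟩ := mem_adjoin2.1 hDw
  obtain ⟨F, hF, hF0⟩ := exists_antideriv f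
  refine ⟨v1, w, F, hadj1, hu, hDv1, by rw [hF, hf], ?_, hF0⟩
  rintro rfl
  apply hs.1.1
  rw [hc, map_zero]

lemma main {D : Derivation K (PolyR K) (PolyR K)}
    (hln : LND K D) (hirr : IrredDer K D) (hrk : rankD K D = 2)
    (u p : PolyR K) (hcu : IsCoord K u) (hu : D u = 0) (hp : D p = 0)
    (hker : ∀ a, D a = 0 → a ∈ Algebra.adjoin K {u, p})
    (s : PolyR K) (hs : IsMinLocalSlice K D s)
    (r : ℕ) (ci : Fin r → Polynomial K) (ni : Fin r → ℕ)
    (hci : ∀ i, Irreducible (ci i)) (hni : ∀ i, 0 < ni i)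
    (hpair : ∀ i j, i ≠ j → ¬ Associated (ci i) (ci j))
    (hc : D s = Polynomial.aeval u (∏ i : Fin r, ci i ^ ni i))
    (hi : Fin r → PolyR K)
    (hgen : ∀ i, aeval u (ci i) ∣ hi i) :
    Triangulable K D ↔
      ∃ (Qs Ls : Fin r → Polynomial (Polynomial K)) (μs : Fin r → Polynomial K),
        (∀ i : Fin r,
          Polynomial.aeval u (ci i) ∣
            (hi i - (ev2 K u (s + ev2 K u p (Ls i)) (Qs i) +
              Polynomial.aeval u (μs i) * p)) ∧
          ∃ ν : Polynomial K, ci i ∣ (μs i * ν - 1)) ∧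
        ∀ ℓ : Polynomial (Polynomial K),
          (∀ i : Fin r,
            Polynomial.aeval u (ci i) ∣ (ev2 K u p ℓ - ev2 K u p (Ls i))) →
          IsSysOfCoords2 K u (s + ev2 K u p ℓ) := by
  simp only [ev2_eq]
  have hDl : ∀ l, D (ev2h u p l) = 0 := fun l => by rw [X_ev2h D hu, hp, mul_zero]
  constructor
  · intro htri
    obtain ⟨v, w, F, T⟩ := forward hln hirr hrk hcu hu hp hker hs hc htri
    obtain ⟨l0, hl0⟩ := mem_adjoin2.1 (hker (v - s) (by rw [map_sub, T.hv, hc, sub_self]))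
    have hv : s + ev2h u p l0 = v := by rw [hl0]; ring
    obtain ⟨P, hP⟩ := T.ker hirr hp
    refine ⟨fun _ => -(P.comp (-F)), fun _ => l0, fun _ => 1, fun i => ⟨?_, 1, by simp⟩, ?_⟩
    · simp only [hv, map_neg, map_one, one_mul]
      have hdc : ci i ∣ ∏ i : Fin r, ci i ^ ni i :=
        (dvd_pow_self _ (hni i).ne').trans
          (Finset.dvd_prod_of_mem (fun i => ci i ^ ni i) (Finset.mem_univ i))
      have := T.p_congr hdc P
      rw [← hP] at this
      have := dvd_sub (hgen i) this
      convert this using 1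
      ring
    · intro l hl
      have he : s + ev2h u p l - v = ev2h u p l - ev2h u p l0 := by rw [← hv]; ring
      refine partii hirr hci hpair T ?_ ?_
      · rw [he, map_sub, hDl, hDl, sub_self]
      · intro i; rw [he]; exact hl i
  · rintro ⟨Qs, Ls, μs, -, h2⟩
    obtain ⟨l, hl⟩ := crt hci hpair Ls
    obtain ⟨w, hw⟩ := h2 l fun i => by
      rw [← map_sub]; exact ev2h_dvd u p (hl i)
    have hDv : D (s + ev2h u p l) = aeval u (∏ i : Fin r, ci i ^ ni i) := by
      rw [map_add, hDl, add_zero, hc]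
    obtain ⟨f, hf⟩ := tri_of hln hw hu hDv
    exact ⟨u, _, w, hw, by rw [hu]; exact Subalgebra.zero_mem _, mem_adjoin1.2 ⟨_, hDv.symm⟩,
      mem_adjoin2.2 ⟨f, hf.symm⟩⟩

end final2


end TR


/-- Main theorem: with `X s = c(u) = ∏ cᵢ^{nᵢ}` and `I_{cᵢ}^X = (cᵢ, hᵢ)` with `hᵢ`
monic in `s`, `X` is triangulable iff (i) each `hᵢ ≡ Qᵢ(u, s + ℓᵢ(u,p)) + μᵢ(u)·p`
modulo `cᵢ` with `μᵢ` invertible mod `cᵢ`, and (ii) for every `ℓ ≡ ℓᵢ mod cᵢ` (all `i`),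
the pair `u, s + ℓ(u,p)` is a system of coordinates of `K[x,y,z]`. -/
theorem main_triangulability {K : Type} [Field K] [CharZero K]
    (X : Derivation K (PolyR K) (PolyR K))
    (hln : LND K X) (hirr : IrredDer K X) (hrk : rankD K X = 2)
    (u p : PolyR K) (hu : IsCoord K u)
    (hker : {a : PolyR K | X a = 0} = (Algebra.adjoin K {u, p} : Subalgebra K (PolyR K)))
    (s : PolyR K) (hs : IsMinLocalSlice K X s)
    (r : ℕ) (ci : Fin r → Polynomial K) (ni : Fin r → ℕ)
    (hci : ∀ i, Irreducible (ci i)) (hni : ∀ i, 0 < ni i)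
    (hpair : ∀ i j, i ≠ j → ¬ Associated (ci i) (ci j))
    (hc : X s = Polynomial.aeval u (∏ i : Fin r, ci i ^ ni i))
    (di : Fin r → ℕ) (ai : (i : Fin r) → Fin (di i) → PolyR K) (hi : Fin r → PolyR K)
    (hai : ∀ i j, ai i j ∈ Algebra.adjoin K {u, p})
    (hmonic : ∀ i : Fin r, hi i = s ^ di i + ∑ j : Fin (di i), ai i j * s ^ (j : ℕ))
    (hgen : ∀ (i : Fin r) (h : PolyR K),
      (Polynomial.aeval u (ci i) ∣ h ∧ h ∈ Algebra.adjoin K {u, p, s}) ↔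
      (∃ α ∈ Algebra.adjoin K {u, p, s}, ∃ β ∈ Algebra.adjoin K {u, p, s},
        h = α * Polynomial.aeval u (ci i) + β * hi i)) :
    Triangulable K X ↔
      ∃ (Qs Ls : Fin r → Polynomial (Polynomial K)) (μs : Fin r → Polynomial K),
        (∀ i : Fin r,
          Polynomial.aeval u (ci i) ∣
            (hi i - (ev2 K u (s + ev2 K u p (Ls i)) (Qs i) +
              Polynomial.aeval u (μs i) * p)) ∧
          ∃ ν : Polynomial K, ci i ∣ (μs i * ν - 1)) ∧
        ∀ ℓ : Polynomial (Polynomial K),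
          (∀ i : Fin r,
            Polynomial.aeval u (ci i) ∣ (ev2 K u p ℓ - ev2 K u p (Ls i))) →
          IsSysOfCoords2 K u (s + ev2 K u p ℓ) := by
  have hu0 : X u = 0 := by
    have : u ∈ {a : PolyR K | X a = 0} := by
      rw [hker]; exact Algebra.subset_adjoin (by simp)
    exact this
  have hp0 : X p = 0 := by
    have : p ∈ {a : PolyR K | X a = 0} := by
      rw [hker]; exact Algebra.subset_adjoin (by simp)
    exact this
  have hk : ∀ a, X a = 0 → a ∈ Algebra.adjoin K {u, p} := by
    intro a ha
    have : a ∈ {a : PolyR K | X a = 0} := ha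
    rw [hker] at this
    exact this
  refine TR.main hln hirr hrk u p hu hu0 hp0 hk s hs r ci ni hci hni hpair hc hi fun i => ?_
  exact ((hgen i (hi i)).2 ⟨0, Subalgebra.zero_mem _, 1, Subalgebra.one_mem _, by ring⟩).1

end
end
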